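/- For every dimension d ≥ 4 there exist convex bodies K ⊆ L ⊆ ℝ^d such that for every integer k ≥ 1 one has E(V_K^k) > E(V_L^k). -/

import Mathlib

open MeasureTheory

/-- A convex body in `ℝ^d`: a compact convex set with nonempty interior. -/
def IsConvexBody {d : ℕ} (K : Set (EuclideanSpace ℝ (Fin d))) : Prop :=
  IsCompact K ∧ Convex ℝ K ∧ (interior K).Nonempty

/-- `E(V_K^k)`: the `k`-th moment of the volume of the convex hull of `d+1`
independent uniformly random points in `K`. -/
noncomputable def momentVolSimplex (d k : ℕ) (K : Set (EuclideanSpace ℝ (Fin d))) : ℝ :=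
  ⨍ X : Fin (d + 1) → EuclideanSpace ℝ (Fin d) in Set.univ.pi (fun _ => K),
    (volume (convexHull ℝ (Set.range X))).toReal ^ k

open scoped ENNReal

namespace RandomSimplex

theorem measurable_fin_cons {E : Type*} [MeasurableSpace E] {n : ℕ} :
    Measurable (fun p : E × (Fin n → E) => (Fin.cons p.1 p.2 : Fin (n + 1) → E)) := by
  refine measurable_pi_lambda _ fun i => ?_
  refine Fin.cases ?_ (fun j => ?_) i
  · simpa using measurable_fst
  · simpa using by fun_prop

section PiLintegral

variable {E : Type*} [MeasureSpace E] [SigmaFinite (volume : Measure E)]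

theorem lintegral_fin_cons {n : ℕ} {φ : (Fin (n + 1) → E) → ℝ≥0∞} (hφ : Measurable φ) :
    ∫⁻ x, φ x = ∫⁻ a : E, ∫⁻ x : Fin n → E, φ (Fin.cons a x) := by
  have h := (volume_preserving_piFinSuccAbove (fun _ : Fin (n + 1) => E) 0).symm
  rw [← h.lintegral_comp hφ, Measure.volume_eq_prod, lintegral_prod]
  · simp [MeasurableEquiv.piFinSuccAbove, Fin.consEquiv]
  · exact (hφ.comp h.measurable).aemeasurable

theorem lintegral_pi_comp {Φ : E → E} (hΦ : Measurable Φ) {c : ℝ≥0∞}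
    (h : ∀ g : E → ℝ≥0∞, Measurable g → ∫⁻ x, g x = c * ∫⁻ x, g (Φ x)) {n : ℕ}
    {φ : (Fin n → E) → ℝ≥0∞} (hφ : Measurable φ) :
    ∫⁻ x, φ x = c ^ n * ∫⁻ x : Fin n → E, φ fun i => Φ (x i) := by
  induction n with
  | zero =>
    rw [pow_zero, one_mul]
    congr 1; funext x; congr 1; exact Subsingleton.elim _ _
  | succ n ih =>
    have hm : Measurable fun x : Fin (n + 1) → E => φ fun i => Φ (x i) := by fun_prop
    rw [lintegral_fin_cons hφ, lintegral_fin_cons hm]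
    have h1 : ∀ a : E, ∫⁻ x : Fin n → E, φ (Fin.cons a x) =
        c ^ n * ∫⁻ x : Fin n → E, φ (Fin.cons a fun i => Φ (x i)) := fun a =>
      ih (hφ.comp (measurable_fin_cons.comp measurable_prodMk_left))
    simp_rw [h1]
    have h2 : Measurable fun a : E => ∫⁻ x : Fin n → E, φ (Fin.cons a fun i => Φ (x i)) := by
      apply Measurable.lintegral_prod_right'
        (f := fun p : E × (Fin n → E) => φ (Fin.cons p.1 fun i => Φ (p.2 i)))
      exact hφ.comp (measurable_fin_cons.comp
        (g := fun p : E × (Fin n → E) => (Fin.cons p.1 p.2 : Fin (n + 1) → E))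
        (f := fun p : E × (Fin n → E) => (p.1, fun i => Φ (p.2 i))) (by fun_prop))
    rw [lintegral_const_mul _ h2, h _ h2, pow_succ, mul_assoc]
    congr 3
    funext a
    congr 1
    funext x
    congr 1
    funext i
    refine Fin.cases ?_ (fun j => ?_) i <;> simp

/-- If integrating against the weights `f` and `g` agrees up to the factor `c` on all functions that
are homogeneous for the maps `T j`, then the same holds in every row of a product space. -/
theorem lintegral_pi_weight {J : Type*} {T : J → E → E} {a : J → ℝ≥0∞} (ha : ∀ j, a j ≠ ∞)
    {f g : E → ℝ≥0∞}
    (hf : Measurable f) (hg : Measurable g) {c : ℝ≥0∞}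
    (h : ∀ u : E → ℝ≥0∞, Measurable u → (∀ j x, u (T j x) = a j * u x) →
      ∫⁻ x, u x * f x = c * ∫⁻ x, u x * g x)
    {n : ℕ} {φ : (Fin n → E) → ℝ≥0∞} (hφ : Measurable φ)
    (hT : ∀ j i x, φ (Function.update x i (T j (x i))) = a j * φ x) :
    ∫⁻ x, φ x * ∏ i, f (x i) = c ^ n * ∫⁻ x, φ x * ∏ i, g (x i) := by
  induction n with
  | zero => simp
  | succ n ih =>
    have hcons : ∀ w : E, Measurable fun x : Fin n → E => φ (Fin.cons w x) := fun w =>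
      hφ.comp (measurable_fin_cons.comp measurable_prodMk_left)
    rw [lintegral_fin_cons (by fun_prop), lintegral_fin_cons (by fun_prop)]
    simp only [Fin.prod_univ_succ, Fin.cons_zero, Fin.cons_succ]
    have h1 : ∀ w : E, ∫⁻ x : Fin n → E, φ (Fin.cons w x) * (f w * ∏ i, f (x i)) =
        c ^ n * ((∫⁻ x : Fin n → E, φ (Fin.cons w x) * ∏ i, g (x i)) * f w) := by
      intro w
      have hw := hcons w
      have := ih (hcons w) (fun j i x => by
        rw [← hT j i.succ, ← Fin.cons_update]; simp)
      rw [← mul_assoc, ← this, ← lintegral_mul_const _ (show Measurable fun x : Fin n → E =>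
          φ (Fin.cons w x) * ∏ i, f (x i) from hw.mul (by fun_prop))]
      congr 1; funext x; ring
    have h2 : ∀ w : E, ∫⁻ x : Fin n → E, φ (Fin.cons w x) * (g w * ∏ i, g (x i)) =
        (∫⁻ x : Fin n → E, φ (Fin.cons w x) * ∏ i, g (x i)) * g w := by
      intro w
      have hw := hcons w
      rw [← lintegral_mul_const _ (show Measurable fun x : Fin n → E =>
          φ (Fin.cons w x) * ∏ i, g (x i) from hw.mul (by fun_prop))]
      congr 1; funext x; ring
    have hU : Measurable fun w : E => ∫⁻ x : Fin n → E, φ (Fin.cons w x) * ∏ i, g (x i) := by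
      apply Measurable.lintegral_prod_right'
        (f := fun p : E × (Fin n → E) => φ (Fin.cons p.1 p.2) * ∏ i, g (p.2 i))
      exact (hφ.comp measurable_fin_cons).mul (by fun_prop)
    simp_rw [h1, h2]
    rw [lintegral_const_mul _ (by fun_prop), h _ hU, pow_succ, mul_assoc]
    intro j w
    rw [← lintegral_const_mul' _ _ (ha j)]
    congr 1; funext x
    rw [← mul_assoc, ← hT j 0 (Fin.cons w x)]
    simp

end PiLintegral

/-- The Gaussian weight `exp (-q / 2)`. -/
noncomputable def gaussWeight (q : ℝ) : ℝ≥0∞ := ENNReal.ofReal (Real.exp (-q / 2))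

/-- The indicator function of `q < 1`. -/
noncomputable def ballWeight (q : ℝ) : ℝ≥0∞ := (Set.Iio (1 : ℝ)).indicator 1 q

/-- The half-line moment `∫ t in (0, ∞), t ^ s * exp (-t ^ 2 / 2)`. -/
noncomputable def halfMoment (s : ℕ) : ℝ≥0∞ :=
  ∫⁻ t in Set.Ioi (0 : ℝ), ENNReal.ofReal (t ^ s * Real.exp (-t ^ 2 / 2))

@[fun_prop]
theorem measurable_gaussWeight : Measurable gaussWeight := by
  unfold gaussWeight; fun_prop

@[fun_prop]
theorem measurable_ballWeight : Measurable ballWeight :=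
  measurable_one.indicator measurableSet_Iio

theorem halfMoment_eq (s : ℕ) :
    halfMoment s =
      ENNReal.ofReal (2 ^ (((s : ℝ) - 1) / 2) * Real.Gamma (((s : ℝ) + 1) / 2)) := by
  have h := integral_rpow_mul_exp_neg_mul_rpow (p := 2) (q := s) (b := 1 / 2) (by norm_num)
    (by have : (0 : ℝ) ≤ s := by positivity
        linarith) (by norm_num)
  have hi := integrableOn_rpow_mul_exp_neg_mul_rpow (p := 2) (s := s) (b := 1 / 2)
    (by have : (0 : ℝ) ≤ s := by positivity
        linarith) (by norm_num) (by norm_num)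
  have hfun : ∀ t : ℝ, t ^ (s : ℝ) * Real.exp (-(1 / 2) * t ^ (2 : ℝ)) =
      t ^ s * Real.exp (-t ^ 2 / 2) := by
    intro t
    rw [Real.rpow_natCast, Real.rpow_two]
    ring_nf
  simp_rw [hfun] at h hi
  rw [halfMoment, ← ofReal_integral_eq_lintegral_ofReal hi, h]
  · congr 1
    rw [show (1 / 2 : ℝ) = 2⁻¹ by norm_num, Real.inv_rpow (by norm_num),
      ← Real.rpow_neg (by norm_num)]
    congr 1
    rw [show ((s : ℝ) - 1) / 2 = -(-((s : ℝ) + 1) / 2) - 1 by ring, Real.rpow_sub (by norm_num)]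
    norm_num
    ring
  · filter_upwards [ae_restrict_mem measurableSet_Ioi] with t ht
    have : (0 : ℝ) < t := ht
    positivity

theorem gaussWeight_eq_lintegral {q : ℝ} (hq : 0 ≤ q) :
    gaussWeight q = ∫⁻ t in Set.Ioi (0 : ℝ),
      ENNReal.ofReal (t * Real.exp (-t ^ 2 / 2)) * ballWeight (q / t ^ 2) := by
  have hderiv : ∀ x ∈ Set.Ici (√q), HasDerivAt (fun t : ℝ => -Real.exp (-t ^ 2 / 2))
      (x * Real.exp (-x ^ 2 / 2)) x := by
    intro x _
    have h1 : HasDerivAt (fun t : ℝ => -t ^ 2 / 2) (-x) x := by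
      refine ((hasDerivAt_pow 2 x).fun_neg.div_const 2).congr_deriv ?_
      norm_num
      ring
    refine h1.exp.fun_neg.congr_deriv ?_
    ring
  have hpos : ∀ x ∈ Set.Ioi (√q), 0 ≤ x * Real.exp (-x ^ 2 / 2) := fun x hx => by
    have : 0 < x := (Real.sqrt_nonneg q).trans_lt hx
    positivity
  have hlim : Filter.Tendsto (fun t : ℝ => -Real.exp (-t ^ 2 / 2)) Filter.atTop (nhds 0) := by
    rw [← neg_zero]
    refine (Real.tendsto_exp_atBot.comp ?_).neg
    have : Filter.Tendsto (fun t : ℝ => t ^ 2 / 2) Filter.atTop Filter.atTop :=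
      (Filter.tendsto_pow_atTop (by norm_num)).atTop_div_const (by norm_num)
    refine (Filter.tendsto_neg_atTop_atBot.comp this).congr fun t => ?_
    simp [neg_div]
  have hInt := integral_Ioi_of_hasDerivAt_of_nonneg' hderiv hpos hlim
  have hI := integrableOn_Ioi_deriv_of_nonneg' hderiv hpos hlim
  have key : ∀ t ∈ Set.Ioi (0 : ℝ),
      ENNReal.ofReal (t * Real.exp (-t ^ 2 / 2)) * ballWeight (q / t ^ 2) =
      (Set.Ioi (√q)).indicator (fun t => ENNReal.ofReal (t * Real.exp (-t ^ 2 / 2))) t := by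
    intro t ht
    have ht0 : (0 : ℝ) < t := ht
    have hiff : q / t ^ 2 < 1 ↔ √q < t := by
      rw [div_lt_one (by positivity), Real.sqrt_lt hq ht0.le]
    by_cases h : √q < t
    · simp [ballWeight, hiff.2 h, h]
    · simp [ballWeight, hiff.not.2 h, h]
  rw [setLIntegral_congr_fun measurableSet_Ioi key, setLIntegral_indicator measurableSet_Ioi,
    Set.inter_eq_left.2 (Set.Ioi_subset_Ioi (Real.sqrt_nonneg q)),
    ← ofReal_integral_eq_lintegral_ofReal hI, hInt]
  · simp [gaussWeight, Real.sq_sqrt hq, neg_div]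
  · filter_upwards [ae_restrict_mem measurableSet_Ioi] with t ht using hpos t ht

section Haar

variable {E : Type*} [NormedAddCommGroup E] [NormedSpace ℝ E] [FiniteDimensional ℝ E]
  [MeasureSpace E] [BorelSpace E] [(volume : Measure E).IsAddHaarMeasure]

theorem lintegral_smul_eq {t : ℝ} (ht : 0 < t) (F : E → ℝ≥0∞) :
    ∫⁻ x, F x = ENNReal.ofReal t ^ Module.finrank ℝ E * ∫⁻ x, F (t • x) := by
  have h := lintegral_map_equiv F (μ := (volume : Measure E))
    (Homeomorph.smulOfNeZero t ht.ne').toMeasurableEquiv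
  simp only [Homeomorph.toMeasurableEquiv_coe, Homeomorph.smulOfNeZero_apply] at h
  have hmap : Measure.map (fun x : E => t • x) volume =
      ENNReal.ofReal (t ^ Module.finrank ℝ E)⁻¹ • volume := by
    have := Measure.map_addHaar_smul (volume : Measure E) ht.ne'
    rw [abs_of_pos (by positivity)] at this
    exact this
  rw [hmap, lintegral_smul_measure] at h
  rw [← h, smul_eq_mul, ← mul_assoc, ← ENNReal.ofReal_pow ht.le,
    ← ENNReal.ofReal_mul (by positivity),
    mul_inv_cancel₀ (by positivity), ENNReal.ofReal_one, one_mul]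

theorem lintegral_homogeneous_mul_gaussWeight {q : E → ℝ} (hqm : Measurable q)
    (hq0 : ∀ x, 0 ≤ q x) (hq : ∀ (t : ℝ) x, q (t • x) = t ^ 2 * q x) {m : ℕ} {u : E → ℝ≥0∞}
    (hum : Measurable u) (hu : ∀ (t : ℝ) x, 0 < t → u (t • x) = ENNReal.ofReal t ^ m * u x) :
    ∫⁻ x, u x * gaussWeight (q x) =
      halfMoment (m + Module.finrank ℝ E + 1) * ∫⁻ x, u x * ballWeight (q x) := by
  simp_rw [gaussWeight_eq_lintegral (hq0 _)]
  have h1 : ∀ x, u x * ∫⁻ t in Set.Ioi (0 : ℝ),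
      ENNReal.ofReal (t * Real.exp (-t ^ 2 / 2)) * ballWeight (q x / t ^ 2) =
      ∫⁻ t in Set.Ioi (0 : ℝ),
      u x * (ENNReal.ofReal (t * Real.exp (-t ^ 2 / 2)) * ballWeight (q x / t ^ 2)) := by
    intro x
    rw [lintegral_const_mul _ (by fun_prop)]
  simp_rw [h1]
  rw [lintegral_lintegral_swap (by fun_prop), halfMoment, ← lintegral_mul_const _ (by fun_prop)]
  refine setLIntegral_congr_fun measurableSet_Ioi fun t ht => ?_
  have ht0 : (0 : ℝ) < t := ht
  rw [lintegral_smul_eq ht0]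
  have h2 : ∀ x, u (t • x) * (ENNReal.ofReal (t * Real.exp (-t ^ 2 / 2)) *
      ballWeight (q (t • x) / t ^ 2)) = (ENNReal.ofReal t ^ m *
        ENNReal.ofReal (t * Real.exp (-t ^ 2 / 2))) * (u x * ballWeight (q x)) := by
    intro x
    rw [hu t x ht0, hq, mul_div_cancel_left₀ _ (by positivity)]
    ring
  simp_rw [h2]
  rw [lintegral_const_mul _ (by fun_prop), ← mul_assoc, ← mul_assoc]
  congr 1
  rw [← ENNReal.ofReal_pow ht0.le, ← ENNReal.ofReal_pow ht0.le,
    ← ENNReal.ofReal_mul (by positivity), ← ENNReal.ofReal_mul (by positivity)]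
  congr 1
  ring

/-- Row-wise passage from Gaussian to ball averages for row-homogeneous functions. -/
theorem lintegral_pi_gaussWeight {q : E → ℝ} (hqm : Measurable q)
    (hq0 : ∀ x, 0 ≤ q x) (hq : ∀ (t : ℝ) x, q (t • x) = t ^ 2 * q x) {m n : ℕ}
    {φ : (Fin n → E) → ℝ≥0∞} (hφ : Measurable φ)
    (hT : ∀ (t : ℝ) i x, 0 < t →
      φ (Function.update x i (t • x i)) = ENNReal.ofReal t ^ m * φ x) :
    ∫⁻ x, φ x * ∏ i, gaussWeight (q (x i)) =
      halfMoment (m + Module.finrank ℝ E + 1) ^ n * ∫⁻ x, φ x * ∏ i, ballWeight (q (x i)) :=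
  lintegral_pi_weight (J := {t : ℝ // 0 < t}) (T := fun t x => (t : ℝ) • x)
    (a := fun t => ENNReal.ofReal t ^ m) (fun t => by simp) (f := fun x => gaussWeight (q x))
    (g := fun x => ballWeight (q x)) (by fun_prop) (by fun_prop)
    (fun u hu h => lintegral_homogeneous_mul_gaussWeight hqm hq0 hq hu
      fun t x ht => h ⟨t, ht⟩ x) hφ fun t i x => hT t i x t.2

end Haar

variable {d : ℕ}

/-- The matrix with first column `ξ` and remaining rows `y i`. -/
def aug (ξ : Fin (d + 1) → ℝ) (y : Fin (d + 1) → Fin d → ℝ) :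
    Matrix (Fin (d + 1)) (Fin (d + 1)) ℝ :=
  Matrix.of fun i => Fin.cons (ξ i) (y i)

/-- `d!` times the signed volume of the simplex with vertices `y i`. -/
noncomputable def sdet (y : Fin (d + 1) → Fin d → ℝ) : ℝ := (aug 1 y).det

@[simp] theorem aug_zero (ξ : Fin (d + 1) → ℝ) (y : Fin (d + 1) → Fin d → ℝ) (i) :
    aug ξ y i 0 = ξ i := rfl

@[simp] theorem aug_succ (ξ : Fin (d + 1) → ℝ) (y : Fin (d + 1) → Fin d → ℝ) (i) (j : Fin d) :
    aug ξ y i j.succ = y i j := rfl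

theorem continuous_det_aug :
    Continuous fun p : (Fin (d + 1) → ℝ) × (Fin (d + 1) → Fin d → ℝ) => (aug p.1 p.2).det := by
  refine Continuous.matrix_det (continuous_matrix fun i j => ?_)
  refine Fin.cases ?_ (fun j => ?_) j
  · simp only [aug_zero]; fun_prop
  · simp only [aug_succ]; fun_prop

theorem continuous_sdet : Continuous (sdet (d := d)) :=
  continuous_det_aug.comp (by fun_prop : Continuous fun y => ((1 : Fin (d + 1) → ℝ), y))

@[fun_prop]
theorem measurable_sdet : Measurable (sdet (d := d)) := continuous_sdet.measurable

@[fun_prop]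
theorem measurable_det_aug :
    Measurable fun p : (Fin (d + 1) → ℝ) × (Fin (d + 1) → Fin d → ℝ) => (aug p.1 p.2).det :=
  continuous_det_aug.measurable

theorem continuous_det_rows {n : ℕ} :
    Continuous fun y : Fin n → Fin n → ℝ => (Matrix.of y).det :=
  Continuous.matrix_det (continuous_matrix fun i j => by simp only [Matrix.of_apply]; fun_prop)

@[fun_prop]
theorem measurable_det_rows {n : ℕ} :
    Measurable fun y : Fin n → Fin n → ℝ => (Matrix.of y).det := continuous_det_rows.measurable

theorem det_aug_single (m : Fin (d + 1)) (r : ℝ) (y : Fin (d + 1) → Fin d → ℝ) :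
    (aug (Pi.single m r) y).det =
      (-1) ^ (m : ℕ) * r * (Matrix.of fun j => y (m.succAbove j)).det := by
  rw [Matrix.det_succ_column_zero, Finset.sum_eq_single m]
  · simp only [aug_zero, Pi.single_eq_same]
    rfl
  · intro i _ hi
    simp [hi]
  · simp

theorem sdet_eq_det_sub (m : Fin (d + 1)) (y : Fin (d + 1) → Fin d → ℝ) :
    sdet y = (-1) ^ (m : ℕ) * (Matrix.of fun j => y (m.succAbove j) - y m).det := by
  have h := Matrix.det_eq_of_forall_row_eq_smul_add_const (A := aug 1 y)
    (B := aug (Pi.single m 1) (fun i => if i = m then y m else y i - y m))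
    (fun i => if i = m then 0 else 1) m (by simp) (fun i j => by
      refine Fin.cases ?_ (fun j => ?_) j
      · by_cases hi : i = m <;> simp [hi]
      · by_cases hi : i = m <;> simp [hi])
  rw [sdet, h, det_aug_single, mul_one]
  congr 2
  ext j k
  simp [Fin.succAbove_ne]

theorem sdet_affine (A : Matrix (Fin d) (Fin d) ℝ) (p : Fin d → ℝ)
    (y : Fin (d + 1) → Fin d → ℝ) :
    sdet (fun i => A.mulVec (y i) + p) = A.det * sdet y := by
  rw [sdet_eq_det_sub 0, sdet_eq_det_sub 0, ← Matrix.det_transpose A, mul_left_comm,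
    mul_comm A.transpose.det, ← Matrix.det_mul]
  congr 2
  ext j k
  simp [Matrix.mul_apply, Matrix.mulVec, dotProduct, mul_sub, mul_comm]

theorem sdet_smul (t : ℝ) (y : Fin (d + 1) → Fin d → ℝ) : sdet (t • y) = t ^ d * sdet y := by
  have := sdet_affine (t • (1 : Matrix (Fin d) (Fin d) ℝ)) 0 y
  rw [Matrix.det_smul, Matrix.det_one, Fintype.card_fin, mul_one] at this
  rw [← this]
  congr 1
  ext i j
  simp [Matrix.smul_mulVec]

theorem det_aug_update_smul (t : ℝ) (i : Fin (d + 1)) (ξ : Fin (d + 1) → ℝ)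
    (y : Fin (d + 1) → Fin d → ℝ) :
    (aug (Function.update ξ i (t * ξ i)) (Function.update y i (t • y i))).det =
      t * (aug ξ y).det := by
  have h := Matrix.det_updateRow_smul (aug ξ y) i t (aug ξ y i)
  rw [Matrix.updateRow_eq_self] at h
  rw [← h]
  congr 1
  ext a b
  rw [Matrix.updateRow_apply]
  refine Fin.cases ?_ (fun j => ?_) b <;> by_cases ha : a = i
  · subst ha; simp
  · simp [ha]
  · subst ha; simp
  · simp [ha]

theorem ae_sdet_ne_zero : ∀ᵐ y : Fin (d + 1) → Fin d → ℝ, sdet y ≠ 0 := by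
  let v : Fin (d + 1) → Fin d → ℝ := Fin.cons 0 fun j => Pi.single j 1
  let S : Set (Fin (d + 1) → Fin d → ℝ) := {y | sdet y = 0}
  have hS : MeasurableSet S := measurable_sdet (measurableSet_singleton 0)
  have hline : ∀ y : Fin (d + 1) → Fin d → ℝ, {t : ℝ | sdet (y + t • v) = 0}.Finite := by
    intro y
    set B : Matrix (Fin d) (Fin d) ℝ := Matrix.of fun j => y j.succ - y 0
    have hB : ∀ t : ℝ, sdet (y + t • v) = (-B).charpoly.eval t := by
      intro t
      rw [sdet_eq_det_sub 0, Matrix.eval_charpoly]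
      simp only [Fin.val_zero, pow_zero, one_mul]
      congr 1
      ext j k
      by_cases hjk : j = k
      · subst hjk
        simp [v, B]; ring
      · simp [v, B, hjk, Ne.symm hjk]
    simp_rw [hB]
    exact (((-B).charpoly.roots.toFinset).finite_toSet).subset fun t ht => by
      simpa [(Matrix.charpoly_monic (-B)).ne_zero] using ht
  have h0 : ∫⁻ t : ℝ in Set.Icc 0 1, ∫⁻ y, S.indicator 1 (y + t • v) = 0 := by
    rw [lintegral_lintegral_swap]
    · rw [lintegral_eq_zero_iff']
      · refine Filter.Eventually.of_forall fun y => ?_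
        rw [Pi.zero_apply, lintegral_eq_zero_iff']
        · refine ae_restrict_of_ae ?_
          refine (ae_iff (μ := volume)).2 ?_
          refine measure_mono_null ?_ ((hline y).measure_zero volume)
          intro t ht
          by_contra hc
          exact ht (by simp only [Set.mem_ofPred_eq] at hc; simp [S, hc])
        · exact ((measurable_one.indicator hS).comp (by fun_prop)).aemeasurable
      · refine Measurable.aemeasurable ?_
        apply Measurable.lintegral_prod_right'
          (f := fun p : (Fin (d + 1) → Fin d → ℝ) × ℝ => S.indicator 1 (p.1 + p.2 • v))
        exact (measurable_one.indicator hS).comp (by fun_prop)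
    · exact ((measurable_one.indicator hS).comp (by fun_prop)).aemeasurable
  have h1 : ∀ t : ℝ, ∫⁻ y, S.indicator (1 : (Fin (d + 1) → Fin d → ℝ) → ℝ≥0∞) (y + t • v) =
      volume S := fun t => by
    rw [lintegral_add_right_eq_self (fun y => S.indicator (1 : (Fin (d + 1) → Fin d → ℝ) → ℝ≥0∞) y),
      lintegral_indicator_one hS]
  simp_rw [h1] at h0
  rw [ae_iff]
  simpa [S] using h0

/-- The squared Euclidean norm on `Fin d → ℝ`. -/
def nsq (x : Fin d → ℝ) : ℝ := x ⬝ᵥ x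

theorem nsq_eq (x : Fin d → ℝ) : nsq x = ∑ i, x i ^ 2 := by
  simp [nsq, dotProduct, sq]

theorem nsq_nonneg (x : Fin d → ℝ) : 0 ≤ nsq x := by
  rw [nsq_eq]; positivity

theorem nsq_smul (t : ℝ) (x : Fin d → ℝ) : nsq (t • x) = t ^ 2 * nsq x := by
  simp only [nsq, smul_dotProduct, dotProduct_smul, smul_eq_mul]; ring

theorem continuous_nsq : Continuous (nsq (d := d)) := by
  unfold nsq dotProduct; fun_prop

@[fun_prop]
theorem measurable_nsq : Measurable (nsq (d := d)) := continuous_nsq.measurable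

theorem lintegral_eq_lintegral_mulVec {M : Matrix (Fin d) (Fin d) ℝ} (hM : M.det ≠ 0)
    {F : (Fin d → ℝ) → ℝ≥0∞} (hF : Measurable F) :
    ∫⁻ z, F z = ‖M.det‖ₑ * ∫⁻ w, F (M.mulVec w) := by
  have h := Real.map_matrix_volume_pi_eq_smul_volume_pi hM
  have h2 := lintegral_map (μ := volume) hF
    (Matrix.toLin' M).continuous_of_finiteDimensional.measurable
  rw [h, lintegral_smul_measure] at h2
  simp only [Matrix.toLin'_apply] at h2
  rw [← h2, smul_eq_mul, ← mul_assoc, Real.enorm_eq_ofReal_abs, ← ENNReal.ofReal_mul (abs_nonneg _),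
    ← abs_mul, mul_inv_cancel₀ hM, abs_one, ENNReal.ofReal_one, one_mul]

theorem det_aug_mulVec (y : Fin (d + 1) → Fin d → ℝ) (w : Fin (d + 1) → ℝ) :
    (aug ((aug 1 y).mulVec w) y).det = w 0 * sdet y := by
  have h1 : aug ((aug 1 y).mulVec w) y = (aug 1 y).updateCol 0 ((aug 1 y).mulVec w) := by
    ext i j
    rw [Matrix.updateCol_apply]
    refine Fin.cases ?_ (fun j => ?_) j <;> simp
  rw [h1, ← Matrix.cramer_apply, Matrix.cramer_eq_adjugate_mulVec, Matrix.mulVec_mulVec,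
    Matrix.adjugate_mul, Matrix.smul_mulVec, Matrix.one_mulVec]
  simp [sdet, mul_comm]

theorem aug_mulVec_cons (y : Fin (d + 1) → Fin d → ℝ) (a : ℝ) (b : Fin d → ℝ) (i) :
    (aug 1 y).mulVec (Fin.cons a b) i = a + y i ⬝ᵥ b := by
  simp [Matrix.mulVec, dotProduct, Fin.sum_univ_succ]

theorem lintegral_first_col {f : ℝ → ℝ≥0∞} (hf : Measurable f) (m : ℕ)
    {y : Fin (d + 1) → Fin d → ℝ} (hy : sdet y ≠ 0) :
    ∫⁻ z, ‖(aug z y).det‖ₑ ^ m * ∏ i, f (z i ^ 2 + nsq (y i)) =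
      ∫⁻ a : ℝ, ∫⁻ b : Fin d → ℝ, ‖a‖ₑ ^ m * (‖sdet y‖ₑ ^ (m + 1) *
        ∏ i, f ((a + y i ⬝ᵥ b) ^ 2 + nsq (y i))) := by
  have hm : Measurable fun z : Fin (d + 1) → ℝ => (aug z y).det :=
    measurable_det_aug.comp measurable_prodMk_right
  rw [lintegral_eq_lintegral_mulVec (M := aug 1 y) hy (by fun_prop)]
  simp_rw [det_aug_mulVec]
  have hm2 : Measurable fun w : Fin (d + 1) → ℝ => (aug 1 y).mulVec w :=
    (Matrix.toLin' (aug 1 y)).continuous_of_finiteDimensional.measurable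
  rw [lintegral_fin_cons (by fun_prop)]
  simp_rw [aug_mulVec_cons, Fin.cons_zero]
  rw [← lintegral_const_mul' _ _ (by simp)]
  congr 1; funext a
  rw [← lintegral_const_mul' _ _ (by simp)]
  congr 1; funext b
  rw [enorm_mul, show (aug 1 y).det = sdet y from rfl]
  ring

/-- The inverse square root of `1 + b bᵀ`. -/
noncomputable def invSqrtMat (b : Fin d → ℝ) : Matrix (Fin d) (Fin d) ℝ :=
  1 - (1 / (√(1 + nsq b) * (√(1 + nsq b) + 1))) • Matrix.vecMulVec b b

theorem invSqrtMat_mulVec (b u : Fin d → ℝ) :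
    (invSqrtMat b).mulVec u =
      u - ((b ⬝ᵥ u) / (√(1 + nsq b) * (√(1 + nsq b) + 1))) • b := by
  rw [invSqrtMat, Matrix.sub_mulVec, Matrix.one_mulVec, Matrix.smul_mulVec,
    Matrix.vecMulVec_mulVec]
  congr 1
  ext i
  simp only [one_div, Pi.smul_apply, op_smul_eq_smul, smul_eq_mul]
  ring

theorem det_invSqrtMat (b : Fin d → ℝ) : (invSqrtMat b).det = 1 / √(1 + nsq b) := by
  set r := √(1 + nsq b) with hr
  have hr2 : r ^ 2 = 1 + nsq b := Real.sq_sqrt (by linarith [nsq_nonneg b])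
  have hr0 : 0 < r := Real.sqrt_pos.2 (by linarith [nsq_nonneg b])
  have h := Matrix.det_one_add_replicateCol_mul_replicateRow (ι := Unit)
    (-(1 / (r * (r + 1))) • b) b
  have h2 : invSqrtMat b = 1 + Matrix.replicateCol Unit (-(1 / (r * (r + 1))) • b) *
      Matrix.replicateRow Unit b := by
    ext i j
    simp [invSqrtMat, Matrix.vecMulVec_apply, Matrix.mul_apply, ← hr]
    ring
  rw [h2, h, dotProduct_smul, show b ⬝ᵥ b = nsq b from rfl,
    show nsq b = (r - 1) * (r + 1) by linear_combination -hr2]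
  simp only [smul_eq_mul]
  field_simp
  ring

theorem nsq_invSqrtMat_add (b u : Fin d → ℝ) (a : ℝ) :
    (a + ((invSqrtMat b).mulVec u + (-a / (1 + nsq b)) • b) ⬝ᵥ b) ^ 2 +
      nsq ((invSqrtMat b).mulVec u + (-a / (1 + nsq b)) • b) =
    nsq u + (a / √(1 + nsq b)) ^ 2 := by
  rw [invSqrtMat_mulVec]
  set r := √(1 + nsq b) with hr
  have hr2 : r ^ 2 = 1 + nsq b := Real.sq_sqrt (by linarith [nsq_nonneg b])
  have hr0 : 0 < r := Real.sqrt_pos.2 (by linarith [nsq_nonneg b])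
  rw [← hr2]
  have hb : b ⬝ᵥ b = (r - 1) * (r + 1) := by
    change nsq b = _
    linear_combination -hr2
  have hbu : u ⬝ᵥ b = b ⬝ᵥ u := dotProduct_comm _ _
  simp only [nsq, add_dotProduct, sub_dotProduct, dotProduct_add, dotProduct_sub, smul_dotProduct,
    dotProduct_smul, hb, hbu, smul_eq_mul]
  field_simp
  ring

theorem lintegral_rows_substitution {f : ℝ → ℝ≥0∞} (hf : Measurable f) (m : ℕ) (a : ℝ)
    (b : Fin d → ℝ) :
    ∫⁻ y : Fin (d + 1) → Fin d → ℝ, ‖sdet y‖ₑ ^ m *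
        ∏ i, f ((a + y i ⬝ᵥ b) ^ 2 + nsq (y i)) =
      ENNReal.ofReal (1 / √(1 + nsq b)) ^ (m + (d + 1)) *
        ∫⁻ y : Fin (d + 1) → Fin d → ℝ, ‖sdet y‖ₑ ^ m *
          ∏ i, f (nsq (y i) + (a / √(1 + nsq b)) ^ 2) := by
  have hr0 : 0 < √(1 + nsq b) := Real.sqrt_pos.2 (by linarith [nsq_nonneg b])
  have hm2 : Measurable fun w : Fin d → ℝ => (invSqrtMat b).mulVec w :=
    (Matrix.toLin' (invSqrtMat b)).continuous_of_finiteDimensional.measurable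
  have hdet : ‖(invSqrtMat b).det‖ₑ = ENNReal.ofReal (1 / √(1 + nsq b)) := by
    rw [det_invSqrtMat, Real.enorm_of_nonneg (by positivity)]
  rw [lintegral_pi_comp (Φ := fun u => (invSqrtMat b).mulVec u + (-a / (1 + nsq b)) • b)
    (c := ENNReal.ofReal (1 / √(1 + nsq b))) (by fun_prop) _ (by fun_prop)]
  · simp_rw [nsq_invSqrtMat_add, sdet_affine, enorm_mul, hdet]
    rw [pow_add _ m, mul_comm (ENNReal.ofReal (1 / √(1 + nsq b)) ^ m), mul_assoc]
    congr 1
    rw [← lintegral_const_mul' _ _ (by simp)]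
    congr 1
    funext y
    ring
  · intro g hg
    rw [← lintegral_add_right_eq_self g ((-a / (1 + nsq b)) • b),
      lintegral_eq_lintegral_mulVec (M := invSqrtMat b) _ (by fun_prop), hdet]
    rw [det_invSqrtMat]
    positivity

/-- The constant of the affine Blaschke–Petkantschin formula for hyperplanes. -/
noncomputable def planeConst (d : ℕ) : ℝ≥0∞ :=
  ∫⁻ b : Fin d → ℝ, ENNReal.ofReal (1 / √(1 + nsq b)) ^ (d + 1)

theorem lintegral_det_aug {f : ℝ → ℝ≥0∞} (hf : Measurable f) (m : ℕ) :
    ∫⁻ y : Fin (d + 1) → Fin d → ℝ, ∫⁻ z : Fin (d + 1) → ℝ,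
        ‖(aug z y).det‖ₑ ^ m * ∏ i, f (z i ^ 2 + nsq (y i)) =
      planeConst d * ∫⁻ s : ℝ, ‖s‖ₑ ^ m * ∫⁻ y : Fin (d + 1) → Fin d → ℝ,
        ‖sdet y‖ₑ ^ (m + 1) * ∏ i, f (nsq (y i) + s ^ 2) := by
  have hG : Measurable fun s : ℝ => ∫⁻ y : Fin (d + 1) → Fin d → ℝ,
        ‖sdet y‖ₑ ^ (m + 1) * ∏ i, f (nsq (y i) + s ^ 2) := by
    apply Measurable.lintegral_prod_right'
      (f := fun p : ℝ × (Fin (d + 1) → Fin d → ℝ) =>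
        ‖sdet p.2‖ₑ ^ (m + 1) * ∏ i, f (nsq (p.2 i) + p.1 ^ 2))
    fun_prop
  have h1 : ∀ᵐ y : Fin (d + 1) → Fin d → ℝ, (∫⁻ z : Fin (d + 1) → ℝ,
        ‖(aug z y).det‖ₑ ^ m * ∏ i, f (z i ^ 2 + nsq (y i))) =
      ∫⁻ p : ℝ × (Fin d → ℝ), ‖p.1‖ₑ ^ m * (‖sdet y‖ₑ ^ (m + 1) *
        ∏ i, f ((p.1 + y i ⬝ᵥ p.2) ^ 2 + nsq (y i))) := by
    filter_upwards [ae_sdet_ne_zero] with y hy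
    rw [lintegral_first_col hf m hy, Measure.volume_eq_prod, lintegral_prod _ (by fun_prop)]
  rw [lintegral_congr_ae h1, lintegral_lintegral_swap (by fun_prop)]
  have h2 : ∀ p : ℝ × (Fin d → ℝ), ∫⁻ y : Fin (d + 1) → Fin d → ℝ,
      ‖p.1‖ₑ ^ m * (‖sdet y‖ₑ ^ (m + 1) * ∏ i, f ((p.1 + y i ⬝ᵥ p.2) ^ 2 + nsq (y i))) =
      ‖p.1‖ₑ ^ m * (ENNReal.ofReal (1 / √(1 + nsq p.2)) ^ (m + 1 + (d + 1)) *
        ∫⁻ y : Fin (d + 1) → Fin d → ℝ, ‖sdet y‖ₑ ^ (m + 1) *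
          ∏ i, f (nsq (y i) + (p.1 / √(1 + nsq p.2)) ^ 2)) := by
    intro p
    rw [lintegral_const_mul _ (by fun_prop), lintegral_rows_substitution hf]
  simp_rw [h2]
  have hmeas : Measurable fun p : ℝ × (Fin d → ℝ) => ∫⁻ y : Fin (d + 1) → Fin d → ℝ,
      ‖sdet y‖ₑ ^ (m + 1) * ∏ i, f (nsq (y i) + (p.1 / √(1 + nsq p.2)) ^ 2) :=
    hG.comp (g := fun s : ℝ => ∫⁻ y : Fin (d + 1) → Fin d → ℝ,
        ‖sdet y‖ₑ ^ (m + 1) * ∏ i, f (nsq (y i) + s ^ 2))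
      (f := fun p : ℝ × (Fin d → ℝ) => p.1 / √(1 + nsq p.2)) (by fun_prop)
  rw [Measure.volume_eq_prod, lintegral_prod_symm _ (by fun_prop), planeConst,
    ← lintegral_mul_const _ (by fun_prop)]
  congr 1
  funext b
  have hr0 : 0 < √(1 + nsq b) := Real.sqrt_pos.2 (by linarith [nsq_nonneg b])
  have hmeas' := hmeas.comp (measurable_prodMk_right (y := b))
  simp only [Function.comp_def] at hmeas'
  rw [lintegral_smul_eq hr0, ← lintegral_const_mul' _ _ (by simp),
    ← lintegral_const_mul' _ _ (by simp)]
  congr 1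
  funext s
  rw [smul_eq_mul, mul_div_cancel_left₀ _ hr0.ne', enorm_mul, Real.enorm_of_nonneg hr0.le,
    Module.finrank_self]
  have hc : ENNReal.ofReal √(1 + nsq b) * ENNReal.ofReal (1 / √(1 + nsq b)) = 1 := by
    rw [← ENNReal.ofReal_mul hr0.le, mul_one_div_cancel hr0.ne', ENNReal.ofReal_one]
  set R := ENNReal.ofReal √(1 + nsq b)
  set R' := ENNReal.ofReal (1 / √(1 + nsq b))
  set G := ∫⁻ y : Fin (d + 1) → Fin d → ℝ, ‖sdet y‖ₑ ^ (m + 1) * ∏ i, f (nsq (y i) + s ^ 2)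
  calc R ^ 1 * ((R * ‖s‖ₑ) ^ m * (R' ^ (m + 1 + (d + 1)) * G))
      = (R * R') ^ (m + 1) * (R' ^ (d + 1) * (‖s‖ₑ ^ m * G)) := by ring
    _ = _ := by rw [hc, one_pow, one_mul]

theorem planeConst_ne_zero : planeConst d ≠ 0 := by
  rw [planeConst, Ne, lintegral_eq_zero_iff (by fun_prop)]
  intro h
  obtain ⟨b, hb⟩ := h.exists
  have hr0 : 0 < √(1 + nsq b) := Real.sqrt_pos.2 (by linarith [nsq_nonneg b])
  simp [hr0] at hb

theorem sq_norm_le_nsq (x : Fin d → ℝ) : ‖x‖ ^ 2 ≤ nsq x := by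
  refine (Real.le_sqrt (norm_nonneg x) (nsq_nonneg x)).1 ?_
  refine (pi_norm_le_iff_of_nonneg (Real.sqrt_nonneg _)).2 fun i => ?_
  refine Real.le_sqrt_of_sq_le ?_
  rw [nsq_eq, Real.norm_eq_abs, sq_abs]
  exact Finset.single_le_sum (f := fun i => x i ^ 2) (fun i _ => sq_nonneg _) (Finset.mem_univ i)

theorem planeConst_ne_top : planeConst d ≠ ∞ := by
  have h := finite_integral_one_add_norm (μ := (volume : Measure (Fin d → ℝ)))
    (r := (d : ℝ) + 1) (by simp)
  have h2 := ENNReal.mul_lt_top (ENNReal.ofReal_lt_top (r := 2 ^ (d + 1))) h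
  rw [← lintegral_const_mul' _ _ (by simp)] at h2
  refine (lt_of_le_of_lt (lintegral_mono fun b => ?_) h2).ne
  have hr0 : 0 < √(1 + nsq b) := Real.sqrt_pos.2 (by linarith [nsq_nonneg b])
  have hle : 1 + ‖b‖ ≤ 2 * √(1 + nsq b) := by
    have h1 : √(1 + nsq b) ^ 2 = 1 + nsq b := Real.sq_sqrt (by linarith [nsq_nonneg b])
    have h2 := sq_norm_le_nsq b
    nlinarith [sq_nonneg (‖b‖ - 1), norm_nonneg b]
  rw [← ENNReal.ofReal_mul (by positivity), ← ENNReal.ofReal_pow (by positivity)]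
  refine ENNReal.ofReal_le_ofReal ?_
  rw [show -((d : ℝ) + 1) = -((d + 1 : ℕ) : ℝ) by push_cast; ring, Real.rpow_neg (by positivity),
    Real.rpow_natCast, ← inv_pow, ← mul_pow]
  refine pow_le_pow_left₀ (by positivity) ?_ _
  rw [← div_eq_mul_inv, div_le_div_iff₀ hr0 (by positivity)]
  linarith

/-- `∫ |sdet y| ^ k` weighted by `w (|y i| ^ 2)` in every row. -/
noncomputable def simplexMoment (w : ℝ → ℝ≥0∞) (d k : ℕ) : ℝ≥0∞ :=
  ∫⁻ y : Fin (d + 1) → Fin d → ℝ, ‖sdet y‖ₑ ^ k * ∏ i, w (nsq (y i))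

/-- `∫ |det y| ^ k` weighted by `w (|y i| ^ 2)` in every row. -/
noncomputable def detMoment (w : ℝ → ℝ≥0∞) (d k : ℕ) : ℝ≥0∞ :=
  ∫⁻ y : Fin d → Fin d → ℝ, ‖(Matrix.of y).det‖ₑ ^ k * ∏ i, w (nsq (y i))

/-- The determinant moment in dimension `d + 1`, with the first column split off. -/
noncomputable def augMoment (w : ℝ → ℝ≥0∞) (d k : ℕ) : ℝ≥0∞ :=
  ∫⁻ y : Fin (d + 1) → Fin d → ℝ, ∫⁻ z : Fin (d + 1) → ℝ,
    ‖(aug z y).det‖ₑ ^ k * ∏ i, w (z i ^ 2 + nsq (y i))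

/-- The volume of the Euclidean unit ball of `Fin d → ℝ`. -/
noncomputable def ballVol (d : ℕ) : ℝ≥0∞ := ∫⁻ x : Fin d → ℝ, ballWeight (nsq x)

/-- The integral `∫ |s| ^ m * (1 - s ^ 2) ^ (e / 2)` over `(-1, 1)`. -/
noncomputable def sliceMoment (m e : ℕ) : ℝ≥0∞ :=
  ∫⁻ s : ℝ, ‖s‖ₑ ^ m * ENNReal.ofReal √(1 - s ^ 2) ^ e

theorem prod_gaussWeight {ι : Type*} (s : Finset ι) (q : ι → ℝ) :
    ∏ i ∈ s, gaussWeight (q i) = gaussWeight (∑ i ∈ s, q i) := by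
  simp only [gaussWeight]
  rw [← ENNReal.ofReal_prod_of_nonneg (fun i _ => (Real.exp_pos _).le), ← Real.exp_sum,
    ← Finset.sum_div, ← Finset.sum_neg_distrib]

theorem gaussWeight_add (p q : ℝ) : gaussWeight (p + q) = gaussWeight p * gaussWeight q := by
  rw [gaussWeight, gaussWeight, gaussWeight, ← ENNReal.ofReal_mul (Real.exp_pos _).le,
    ← Real.exp_add]
  congr 2
  ring

theorem lintegral_gaussWeight_nsq :
    ∫⁻ x : Fin d → ℝ, gaussWeight (nsq x) = halfMoment (d + 1) * ballVol d := by
  have h := lintegral_homogeneous_mul_gaussWeight (E := Fin d → ℝ) (q := nsq) (m := 0)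
    (u := fun _ => 1) measurable_nsq nsq_nonneg nsq_smul measurable_const (by simp)
  simpa [ballVol] using h

theorem detMoment_gaussWeight (k : ℕ) :
    detMoment gaussWeight d k = halfMoment (k + d + 1) ^ d * detMoment ballWeight d k := by
  have h := lintegral_pi_gaussWeight (E := Fin d → ℝ) (q := nsq) (m := k) (n := d)
    (φ := fun y => ‖(Matrix.of y).det‖ₑ ^ k) measurable_nsq nsq_nonneg nsq_smul (by fun_prop)
    (fun t i x ht => by
      have := Matrix.det_updateRow_smul (Matrix.of x) i t (x i)
      rw [show (Matrix.of x).updateRow i (x i) = Matrix.of x from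
        Matrix.updateRow_eq_self (Matrix.of x) i] at this
      rw [show Matrix.of (Function.update x i (t • x i)) = (Matrix.of x).updateRow i (t • x i)
        from rfl, this, enorm_mul, mul_pow, Real.enorm_of_nonneg ht.le])
  simpa [detMoment] using h

theorem lintegral_arrow_prod {n : ℕ} {F : Type*} [MeasureSpace F]
    [SigmaFinite (volume : Measure F)] {φ : (Fin n → ℝ) × (Fin n → F) → ℝ≥0∞} (hφ : Measurable φ) :
    ∫⁻ x : Fin n → ℝ × F, φ (fun i => (x i).1, fun i => (x i).2) =
      ∫⁻ y : Fin n → F, ∫⁻ z : Fin n → ℝ, φ (z, y) := by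
  have h := volume_measurePreserving_arrowProdEquivProdArrow ℝ F (Fin n)
  rw [← lintegral_prod_symm _ hφ.aemeasurable, ← Measure.volume_eq_prod, ← h.lintegral_comp hφ]
  rfl

theorem augMoment_gaussWeight (k : ℕ) :
    augMoment gaussWeight d k =
      halfMoment (k + d + 2) ^ (d + 1) * augMoment ballWeight d k := by
  have : (volume : Measure (ℝ × (Fin d → ℝ))).IsAddHaarMeasure := by
    rw [Measure.volume_eq_prod]; infer_instance
  have hmeas : Measurable fun x : Fin (d + 1) → ℝ × (Fin d → ℝ) =>
      (aug (fun i => (x i).1) (fun i => (x i).2)).det :=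
    measurable_det_aug.comp (f := fun x : Fin (d + 1) → ℝ × (Fin d → ℝ) =>
      (fun i => (x i).1, fun i => (x i).2)) (by fun_prop)
  have h := lintegral_pi_gaussWeight (E := ℝ × (Fin d → ℝ))
    (q := fun p => p.1 ^ 2 + nsq p.2) (m := k) (n := d + 1)
    (φ := fun x => ‖(aug (fun i => (x i).1) (fun i => (x i).2)).det‖ₑ ^ k) (by fun_prop)
    (fun p => add_nonneg (sq_nonneg _) (nsq_nonneg _))
    (fun t p => by simp [nsq_smul]; ring) (by fun_prop)
    (fun t i x ht => by
      have := det_aug_update_smul t i (fun i => (x i).1) (fun i => (x i).2)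
      rw [← Real.enorm_of_nonneg ht.le, ← mul_pow, ← enorm_mul, ← this]
      congr 4 <;> ext j <;> by_cases hj : j = i
      · subst hj; simp
      · simp [hj]
      · subst hj; simp
      · simp [hj])
  have e : k + Module.finrank ℝ (ℝ × (Fin d → ℝ)) + 1 = k + d + 2 := by simp; ring
  rw [e] at h
  have h2 : ∀ w : ℝ → ℝ≥0∞, Measurable w → augMoment w d k =
      ∫⁻ x : Fin (d + 1) → ℝ × (Fin d → ℝ),
        ‖(aug (fun i => (x i).1) (fun i => (x i).2)).det‖ₑ ^ k *
          ∏ i, w ((x i).1 ^ 2 + nsq (x i).2) := fun w hw =>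
    (lintegral_arrow_prod (φ := fun p : (Fin (d + 1) → ℝ) × (Fin (d + 1) → Fin d → ℝ) =>
      ‖(aug p.1 p.2).det‖ₑ ^ k * ∏ i, w (p.1 i ^ 2 + nsq (p.2 i))) (by fun_prop)).symm
  rw [h2 _ measurable_gaussWeight, h2 _ measurable_ballWeight, h]

theorem simplexMoment_slice (hd : 0 < d) (k : ℕ) (s : ℝ) :
    ∫⁻ y : Fin (d + 1) → Fin d → ℝ, ‖sdet y‖ₑ ^ k * ∏ i, ballWeight (nsq (y i) + s ^ 2) =
      ENNReal.ofReal √(1 - s ^ 2) ^ (d * (k + d + 1)) * simplexMoment ballWeight d k := by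
  rcases le_or_gt (1 - s ^ 2) 0 with hs | hs
  · have h0 : ∀ y : Fin (d + 1) → Fin d → ℝ, ∏ i, ballWeight (nsq (y i) + s ^ 2) = 0 := by
      intro y
      refine Finset.prod_eq_zero (Finset.mem_univ 0) ?_
      have : ¬ nsq (y 0) + s ^ 2 < 1 := by linarith [nsq_nonneg (y 0)]
      simp [ballWeight, this]
    have : d * (k + d + 1) ≠ 0 := by positivity
    simp [h0, Real.sqrt_eq_zero_of_nonpos hs, this]
  · have ht := Real.sqrt_pos.2 hs
    set t := √(1 - s ^ 2)
    have ht2 : t ^ 2 = 1 - s ^ 2 := Real.sq_sqrt hs.le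
    have hw : ∀ x : Fin d → ℝ, ballWeight (nsq (t • x) + s ^ 2) = ballWeight (nsq x) := by
      intro x
      have : nsq (t • x) + s ^ 2 < 1 ↔ nsq x < 1 := by
        rw [nsq_smul, ht2]
        constructor <;> intro h <;> nlinarith
      by_cases h : nsq x < 1
      · simp [ballWeight, this.2 h, h]
      · simp [ballWeight, this.not.2 h, h]
    rw [lintegral_smul_eq ht, simplexMoment]
    simp_rw [Pi.smul_apply, hw, sdet_smul, enorm_mul, enorm_pow, Real.enorm_of_nonneg ht.le,
      mul_pow, mul_assoc]
    rw [lintegral_const_mul _ (by fun_prop), ← mul_assoc, ← pow_mul, ← pow_add]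
    congr 2
    rw [Module.finrank_pi_fintype]
    simp
    ring

theorem augMoment_ballWeight (hd : 0 < d) (m : ℕ) :
    augMoment ballWeight d m = planeConst d * (sliceMoment m (d * (m + 1 + d + 1)) *
      simplexMoment ballWeight d (m + 1)) := by
  rw [augMoment, lintegral_det_aug measurable_ballWeight]
  simp_rw [simplexMoment_slice hd, ← mul_assoc]
  rw [lintegral_mul_const _ (by fun_prop), sliceMoment, mul_assoc]

theorem lintegral_abs_pow_mul_gaussWeight (m : ℕ) {D : ℝ} (hD : 0 < D) :
    ENNReal.ofReal √D ^ (m + 1) * ∫⁻ s : ℝ, ‖s‖ₑ ^ m * gaussWeight (D * s ^ 2) =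
      2 * halfMoment m := by
  have hD' := Real.sqrt_pos.2 hD
  have h1 : 2 * halfMoment m = ∫⁻ t : ℝ, ‖t‖ₑ ^ m * gaussWeight (t ^ 2) := by
    have hpos : ∫⁻ t in Set.Ioi (0 : ℝ), ‖t‖ₑ ^ m * gaussWeight (t ^ 2) = halfMoment m := by
      refine setLIntegral_congr_fun measurableSet_Ioi fun t ht => ?_
      have ht0 : (0 : ℝ) < t := ht
      rw [gaussWeight, Real.enorm_of_nonneg ht0.le, ENNReal.ofReal_mul (by positivity),
        ENNReal.ofReal_pow ht0.le]
    have hneg : ∫⁻ t in Set.Iic (0 : ℝ), ‖t‖ₑ ^ m * gaussWeight (t ^ 2) = halfMoment m := by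
      rw [← hpos, ← Measure.restrict_congr_set Iio_ae_eq_Iic,
        ← lintegral_indicator measurableSet_Iio, ← lintegral_indicator measurableSet_Ioi,
        ← lintegral_neg_eq_self]
      congr 1
      funext t
      by_cases ht : 0 < t <;> simp [ht]
    rw [← lintegral_add_compl _ (measurableSet_Ioi (a := (0 : ℝ))), Set.compl_Ioi, hpos, hneg,
      two_mul]
  rw [h1, lintegral_smul_eq hD' (fun t => ‖t‖ₑ ^ m * gaussWeight (t ^ 2)),
    ← lintegral_const_mul' _ _ (by simp),
    ← lintegral_const_mul' _ _ (by simp)]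
  congr 1
  funext s
  rw [smul_eq_mul, enorm_mul, mul_pow _ s, Real.sq_sqrt hD.le, Real.enorm_of_nonneg hD'.le,
    Module.finrank_self]
  ring

theorem augMoment_gaussWeight_eq_simplexMoment (m : ℕ) :
    augMoment gaussWeight d m = planeConst d *
      ((∫⁻ s : ℝ, ‖s‖ₑ ^ m * gaussWeight ((d + 1 : ℝ) * s ^ 2)) *
        simplexMoment gaussWeight d (m + 1)) := by
  rw [augMoment, lintegral_det_aug measurable_gaussWeight]
  have h : ∀ (s : ℝ) (y : Fin (d + 1) → Fin d → ℝ), ‖sdet y‖ₑ ^ (m + 1) *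
      ∏ i, gaussWeight (nsq (y i) + s ^ 2) = gaussWeight ((d + 1 : ℝ) * s ^ 2) *
        (‖sdet y‖ₑ ^ (m + 1) * ∏ i, gaussWeight (nsq (y i))) := by
    intro s y
    rw [prod_gaussWeight, prod_gaussWeight, Finset.sum_add_distrib, gaussWeight_add]
    simp
    ring
  simp_rw [h]
  rw [← lintegral_mul_const _ (by fun_prop)]
  congr 2
  funext s
  rw [lintegral_const_mul _ (by fun_prop), simplexMoment, mul_assoc]

theorem lintegral_comp_involutive {E : Type*} [NormedAddCommGroup E] [NormedSpace ℝ E]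
    [FiniteDimensional ℝ E] [MeasureSpace E] [BorelSpace E] [(volume : Measure E).IsAddHaarMeasure]
    (L : E →ₗ[ℝ] E) (hL : L ∘ₗ L = LinearMap.id) {F : E → ℝ≥0∞} (hF : Measurable F) :
    ∫⁻ x, F (L x) = ∫⁻ x, F x := by
  have hdet : L.det * L.det = 1 := by rw [← LinearMap.det_comp, hL, LinearMap.det_id]
  have habs : |L.det| = 1 := by
    rcases mul_self_eq_one_iff.1 hdet with h | h <;> simp [h]
  have hne : L.det ≠ 0 := fun h => by simp [h] at hdet
  have h := Measure.map_linearMap_addHaar_eq_smul_addHaar volume hne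
  rw [abs_inv, habs, inv_one, ENNReal.ofReal_one, one_smul] at h
  rw [← lintegral_map hF L.continuous_of_finiteDimensional.measurable, h]

theorem exists_symm_involutive_mulVec_one (hd : 0 < d) :
    ∃ Q : Matrix (Fin (d + 1)) (Fin (d + 1)) ℝ, Q.transpose = Q ∧ Q * Q = 1 ∧
      Q.mulVec 1 = Pi.single 0 √(d + 1 : ℝ) := by
  set s := √(d + 1 : ℝ)
  have hs2 : s ^ 2 = d + 1 := Real.sq_sqrt (by positivity)
  have hd' : (0 : ℝ) < d := by exact_mod_cast hd
  have hs1 : 1 < s := by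
    rw [Real.lt_sqrt (by norm_num)]; linarith
  have hs1' : s - 1 ≠ 0 := by linarith
  let v : Fin (d + 1) → ℝ := Pi.single 0 s - 1
  have hv1 : v ⬝ᵥ 1 = s - s ^ 2 := by
    simp [v, dotProduct_one, hs2]
  have hvs : v ⬝ᵥ (Pi.single 0 s) = s ^ 2 - s := by
    simp [v]; ring
  have hvv : v ⬝ᵥ v = 2 * (s * (s - 1)) := by
    have : v ⬝ᵥ v = v ⬝ᵥ (Pi.single 0 s) - v ⬝ᵥ 1 := by rw [← dotProduct_sub]
    rw [this, hv1, hvs]; ring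
  refine ⟨1 - (1 / (s * (s - 1))) • Matrix.vecMulVec v v, ?_, ?_, ?_⟩
  · rw [Matrix.transpose_sub, Matrix.transpose_one, Matrix.transpose_smul,
      Matrix.transpose_vecMulVec]
  · have : Matrix.vecMulVec v v * Matrix.vecMulVec v v =
        (2 * (s * (s - 1))) • Matrix.vecMulVec v v := by
      rw [Matrix.vecMulVec_mul_vecMulVec, hvv]
      ext i j
      simp [Matrix.vecMulVec_apply]
      ring
    have h2 : 1 / (s * (s - 1)) * (1 / (s * (s - 1))) * (2 * (s * (s - 1))) =
        1 / (s * (s - 1)) + 1 / (s * (s - 1)) := by field_simp; norm_num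
    generalize 1 / (s * (s - 1)) = c at h2 ⊢
    simp only [sub_mul, mul_sub, one_mul, mul_one]
    rw [smul_mul_smul_comm, this, smul_smul, h2, add_smul]
    abel
  · rw [Matrix.sub_mulVec, Matrix.one_mulVec, Matrix.smul_mulVec, Matrix.vecMulVec_mulVec, hv1]
    have h3 : (1 / (s * (s - 1))) • (MulOpposite.op (s - s ^ 2) • v) = -v := by
      ext i
      simp
      field_simp
      ring
    rw [h3]
    simp [v]

theorem simplexMoment_gaussWeight (hd : 0 < d) (k : ℕ) :
    simplexMoment gaussWeight d k = ENNReal.ofReal √(d + 1 : ℝ) ^ k *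
      (halfMoment (d + 1) * ballVol d * detMoment gaussWeight d k) := by
  obtain ⟨Q, hQt, hQQ, hQ1⟩ := exists_symm_involutive_mulVec_one hd
  let L : (Fin (d + 1) → Fin d → ℝ) →ₗ[ℝ] (Fin (d + 1) → Fin d → ℝ) :=
    { toFun := fun y => Matrix.of.symm (Q * Matrix.of y)
      map_add' := fun x y => by
        rw [← Matrix.of_add_of, Matrix.mul_add]; rfl
      map_smul' := fun t y => by
        rw [← Matrix.smul_of, Matrix.mul_smul]; rfl }
  have hL : L ∘ₗ L = LinearMap.id := by
    refine LinearMap.ext fun y => ?_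
    change Matrix.of.symm (Q * (Q * Matrix.of y)) = y
    rw [← Matrix.mul_assoc, hQQ, Matrix.one_mul]
    rfl
  have hdetQ : ‖Q.det‖ₑ = 1 := by
    have : Q.det * Q.det = 1 := by rw [← Matrix.det_mul, hQQ, Matrix.det_one]
    rcases mul_self_eq_one_iff.1 this with h | h <;> simp [h]
  have haug : ∀ y, ‖sdet y‖ₑ =
      ENNReal.ofReal √(d + 1 : ℝ) * ‖(Matrix.of fun i : Fin d => L y i.succ).det‖ₑ := by
    intro y
    have h1 : aug (Pi.single 0 √(d + 1 : ℝ)) (L y) = Q * aug 1 y := by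
      ext i j
      refine Fin.cases ?_ (fun j => ?_) j
      · rw [aug_zero, ← hQ1]; rfl
      · rfl
    have h2 := congrArg Matrix.det h1
    rw [det_aug_single, Matrix.det_mul] at h2
    have h3 := congrArg enorm h2
    simp only [Fin.val_zero, pow_zero, one_mul, Fin.zero_succAbove, enorm_mul, hdetQ] at h3
    rw [Real.enorm_of_nonneg (Real.sqrt_nonneg _)] at h3
    exact h3.symm
  have hnsq : ∀ y, ∑ i, nsq (L y i) = ∑ i, nsq (y i) := by
    have htr : ∀ y : Fin (d + 1) → Fin d → ℝ,
        ∑ i, nsq (y i) = ((Matrix.of y).transpose * Matrix.of y).trace := by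
      intro y
      simp only [nsq_eq, Matrix.trace, Matrix.diag_apply, Matrix.mul_apply,
        Matrix.transpose_apply, Matrix.of_apply, ← sq]
      exact Finset.sum_comm
    intro y
    rw [htr, htr]
    change ((Q * Matrix.of y).transpose * (Q * Matrix.of y)).trace = _
    rw [Matrix.transpose_mul, hQt, Matrix.mul_assoc, ← Matrix.mul_assoc Q, hQQ, Matrix.one_mul]
  let F : (Fin (d + 1) → Fin d → ℝ) → ℝ≥0∞ := fun y => ENNReal.ofReal √(d + 1 : ℝ) ^ k *
    (‖(Matrix.of fun i : Fin d => y i.succ).det‖ₑ ^ k * ∏ i, gaussWeight (nsq (y i)))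
  have hF : ∀ y, ‖sdet y‖ₑ ^ k * ∏ i, gaussWeight (nsq (y i)) = F (L y) := by
    intro y
    simp only [F]
    rw [haug, prod_gaussWeight, prod_gaussWeight, hnsq, mul_pow, mul_assoc]
  have hm : Measurable fun y : Fin (d + 1) → Fin d → ℝ =>
      (Matrix.of fun i : Fin d => y i.succ).det :=
    measurable_det_rows.comp (g := fun y : Fin d → Fin d → ℝ => (Matrix.of y).det)
      (f := fun y : Fin (d + 1) → Fin d → ℝ => fun i : Fin d => y i.succ) (by fun_prop)
  rw [simplexMoment, lintegral_congr hF, lintegral_comp_involutive L hL (F := F) (by fun_prop)]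
  simp only [F]
  rw [lintegral_const_mul' _ _ (by simp), lintegral_fin_cons (by fun_prop)]
  congr 1
  simp only [Fin.cons_succ, Fin.prod_univ_succ, Fin.cons_zero]
  rw [← lintegral_gaussWeight_nsq, ← lintegral_mul_const _ (by fun_prop)]
  congr 1
  funext a
  rw [detMoment, ← lintegral_const_mul _ (by fun_prop)]
  congr 1
  funext y
  ring

theorem setLIntegral_rpow_mul_one_sub_rpow {α β : ℝ} (hα : 0 < α) (hβ : 0 < β) :
    ∫⁻ x in Set.Ioo (0 : ℝ) 1, ENNReal.ofReal (x ^ (α - 1) * (1 - x) ^ (β - 1)) =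
      ENNReal.ofReal (ProbabilityTheory.beta α β) := by
  have hb := ProbabilityTheory.beta_pos hα hβ
  have h := ProbabilityTheory.lintegral_betaPDF_eq_one hα hβ
  rw [ProbabilityTheory.lintegral_betaPDF] at h
  simp_rw [mul_assoc, ENNReal.ofReal_mul (one_div_pos.2 hb).le] at h
  rw [lintegral_const_mul' _ _ (by simp)] at h
  have hc : ENNReal.ofReal (ProbabilityTheory.beta α β) *
      ENNReal.ofReal (1 / ProbabilityTheory.beta α β) = 1 := by
    rw [← ENNReal.ofReal_mul hb.le, mul_one_div_cancel hb.ne', ENNReal.ofReal_one]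
  rw [← one_mul (∫⁻ _ in _, _), ← hc, mul_assoc, h, mul_one]

theorem sliceMoment_eq (m : ℕ) {e : ℕ} (he : 0 < e) :
    sliceMoment m e =
      ENNReal.ofReal (ProbabilityTheory.beta (((m : ℝ) + 1) / 2) ((e : ℝ) / 2 + 1)) := by
  have hm0 : (0 : ℝ) ≤ m := by positivity
  rw [← setLIntegral_rpow_mul_one_sub_rpow (by positivity) (by positivity)]
  have himg : (fun s : ℝ => s ^ 2) '' Set.Ioo 0 1 = Set.Ioo 0 1 := by
    ext x
    constructor
    · rintro ⟨s, ⟨h0, h1⟩, rfl⟩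
      exact ⟨by positivity, by simp only; nlinarith⟩
    · rintro ⟨h0, h1⟩
      exact ⟨√x, ⟨Real.sqrt_pos.2 h0, by rw [Real.sqrt_lt' one_pos]; simpa using h1⟩,
        Real.sq_sqrt h0.le⟩
  have hpos : ∫⁻ s in Set.Ioi (0 : ℝ), ‖s‖ₑ ^ m * ENNReal.ofReal √(1 - s ^ 2) ^ e =
      ∫⁻ s in Set.Ioo (0 : ℝ) 1, ‖s‖ₑ ^ m * ENNReal.ofReal √(1 - s ^ 2) ^ e := by
    rw [← lintegral_indicator measurableSet_Ioi, ← lintegral_indicator measurableSet_Ioo]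
    congr 1
    funext s
    by_cases h0 : 0 < s
    · by_cases h1 : s < 1
      · simp [h0, h1]
      · have : √(1 - s ^ 2) = 0 := Real.sqrt_eq_zero_of_nonpos (by nlinarith)
        simp [h1, this, he.ne']
    · simp [h0]
  have hneg : ∫⁻ s in Set.Iic (0 : ℝ), ‖s‖ₑ ^ m * ENNReal.ofReal √(1 - s ^ 2) ^ e =
      ∫⁻ s in Set.Ioi (0 : ℝ), ‖s‖ₑ ^ m * ENNReal.ofReal √(1 - s ^ 2) ^ e := by
    rw [← Measure.restrict_congr_set Iio_ae_eq_Iic,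
      ← lintegral_indicator measurableSet_Iio, ← lintegral_indicator measurableSet_Ioi,
      ← lintegral_neg_eq_self]
    congr 1
    funext t
    by_cases ht : 0 < t <;> simp [ht]
  rw [sliceMoment, ← lintegral_add_compl _ (measurableSet_Ioi (a := (0 : ℝ))), Set.compl_Ioi, hneg,
    hpos, ← two_mul]
  conv_rhs => rw [← himg]
  rw [lintegral_image_eq_lintegral_abs_deriv_mul measurableSet_Ioo
    (f' := fun s => 2 * s) (fun x _ => by simpa using (hasDerivAt_pow 2 x).hasDerivWithinAt)
    (fun x hx y hy h => by
      have := (pow_left_inj₀ hx.1.le hy.1.le (two_ne_zero)).1 h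
      exact this), ← lintegral_const_mul' _ _ (by simp)]
  refine setLIntegral_congr_fun measurableSet_Ioo fun s ⟨h0, h1⟩ => ?_
  have h2 : 0 < 1 - s ^ 2 := by nlinarith
  rw [Real.enorm_of_nonneg h0.le, ← ENNReal.ofReal_pow h0.le,
    ← ENNReal.ofReal_pow (Real.sqrt_nonneg _), ← ENNReal.ofReal_mul (by positivity),
    ← ENNReal.ofReal_mul (by positivity), abs_of_pos (by positivity),
    show (2 : ℝ≥0∞) = ENNReal.ofReal 2 by simp, ← ENNReal.ofReal_mul (by norm_num)]
  congr 1
  rw [mul_assoc 2 s, ← mul_assoc s]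
  congr 2
  · rw [← Real.rpow_natCast s 2, ← Real.rpow_mul h0.le]
    nth_rewrite 2 [← Real.rpow_one s]
    rw [← Real.rpow_add h0, ← Real.rpow_natCast]
    congr 1
    push_cast
    ring
  · rw [Real.sqrt_eq_rpow, ← Real.rpow_natCast, ← Real.rpow_mul h2.le]
    congr 1
    ring

/-- The ratio between the simplex moments and the determinant moments of the unit ball. -/
noncomputable def momentRatio (d k : ℕ) : ℝ :=
  Real.Gamma ((d : ℝ) / 2 + 1) * Real.Gamma (((d : ℝ) + 1) * (d + k) / 2 + 1) /
    (Real.Gamma (((d : ℝ) + k) / 2 + 1) * Real.Gamma ((d : ℝ) * (d + k + 1) / 2 + 1))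

theorem halfMoment_ne_zero (s : ℕ) : halfMoment s ≠ 0 := by
  rw [halfMoment_eq, Ne, ENNReal.ofReal_eq_zero, not_le]
  have := Real.Gamma_pos_of_pos (s := ((s : ℝ) + 1) / 2) (by positivity)
  positivity

theorem halfMoment_ne_top (s : ℕ) : halfMoment s ≠ ∞ := by
  rw [halfMoment_eq]; exact ENNReal.ofReal_ne_top

theorem halfMoment_mul_sliceMoment_mul_simplexMoment (hd : 0 < d) (m : ℕ) :
    halfMoment (m + d + 2) * sliceMoment m (d * (m + 1 + d + 1)) *
        simplexMoment ballWeight d (m + 1) =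
      2 * halfMoment m * halfMoment (d + 1) * (ballVol d * detMoment ballWeight d (m + 1)) := by
  have h1 := augMoment_gaussWeight (d := d) m
  rw [augMoment_gaussWeight_eq_simplexMoment, augMoment_ballWeight hd,
    simplexMoment_gaussWeight hd, detMoment_gaussWeight,
    show m + 1 + d + 1 = m + d + 2 by ring] at h1
  have h2 := lintegral_abs_pow_mul_gaussWeight m (D := (d : ℝ) + 1) (by positivity)
  set A := ∫⁻ s : ℝ, ‖s‖ₑ ^ m * gaussWeight (((d : ℝ) + 1) * s ^ 2)
  rw [← h2]
  rw [show m + 1 + d + 1 = m + d + 2 by ring]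
  have hc0 : planeConst d * halfMoment (m + d + 2) ^ d ≠ 0 :=
    mul_ne_zero planeConst_ne_zero (pow_ne_zero _ (halfMoment_ne_zero _))
  have hct : planeConst d * halfMoment (m + d + 2) ^ d ≠ ∞ :=
    ENNReal.mul_ne_top planeConst_ne_top (ENNReal.pow_ne_top (halfMoment_ne_top _))
  rw [← ENNReal.mul_right_inj hc0 hct]
  calc _ = halfMoment (m + d + 2) ^ (d + 1) * (planeConst d *
      (sliceMoment m (d * (m + d + 2)) * simplexMoment ballWeight d (m + 1))) := by ring
    _ = _ := h1.symm
    _ = _ := by ring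

theorem simplexMoment_ballWeight (hd : 0 < d) {k : ℕ} (hk : 1 ≤ k) :
    simplexMoment ballWeight d k =
      ENNReal.ofReal (momentRatio d k) * (ballVol d * detMoment ballWeight d k) := by
  obtain ⟨m, rfl⟩ : ∃ m, k = m + 1 := ⟨k - 1, by omega⟩
  have h := halfMoment_mul_sliceMoment_mul_simplexMoment hd m
  have hd' : (0 : ℝ) < d := by exact_mod_cast hd
  rw [sliceMoment_eq m (by positivity), halfMoment_eq, halfMoment_eq, halfMoment_eq,
    ProbabilityTheory.beta, show (2 : ℝ≥0∞) = ENNReal.ofReal 2 by simp] at h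
  push_cast at h
  have g1 := Real.Gamma_pos_of_pos (s := ((m : ℝ) + d + 2 + 1) / 2) (by positivity)
  have g2 := Real.Gamma_pos_of_pos (s := ((m : ℝ) + 1) / 2) (by positivity)
  have g3 := Real.Gamma_pos_of_pos (s := ((d : ℝ) * (m + 1 + d + 1)) / 2 + 1) (by positivity)
  have g4 := Real.Gamma_pos_of_pos
    (s := ((m : ℝ) + 1) / 2 + (((d : ℝ) * (m + 1 + d + 1)) / 2 + 1)) (by positivity)
  have g5 := Real.Gamma_pos_of_pos (s := ((d : ℝ) + 1 + 1) / 2) (by positivity)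
  rw [← ENNReal.ofReal_mul (by positivity), ← ENNReal.ofReal_mul (by positivity),
    ← ENNReal.ofReal_mul (by positivity)] at h
  set P : ℝ := 2 ^ (((m : ℝ) + d + 2 - 1) / 2) * Real.Gamma (((m : ℝ) + d + 2 + 1) / 2) *
    (Real.Gamma (((m : ℝ) + 1) / 2) * Real.Gamma (((d : ℝ) * (m + 1 + d + 1)) / 2 + 1) /
      Real.Gamma (((m : ℝ) + 1) / 2 + (((d : ℝ) * (m + 1 + d + 1)) / 2 + 1))) with hP
  have hP0 : 0 < P := by positivity
  rw [← ENNReal.mul_right_inj (ENNReal.ofReal_pos.2 hP0).ne' ENNReal.ofReal_ne_top, h,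
    ← mul_assoc (ENNReal.ofReal P), ← ENNReal.ofReal_mul hP0.le]
  congr 2
  rw [hP, momentRatio]
  push_cast
  rw [show (((d : ℝ) + 1) * (d + (m + 1)) / 2 + 1) =
      ((m : ℝ) + 1) / 2 + (((d : ℝ) * (m + 1 + d + 1)) / 2 + 1) by ring,
    show ((d : ℝ) + (m + 1)) / 2 + 1 = ((m : ℝ) + d + 2 + 1) / 2 by ring,
    show (d : ℝ) * (d + (m + 1) + 1) / 2 + 1 = ((d : ℝ) * (m + 1 + d + 1)) / 2 + 1 by ring,
    show (d : ℝ) / 2 + 1 = ((d : ℝ) + 1 + 1) / 2 by ring,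
    show ((m : ℝ) + d + 2 - 1) / 2 = 1 + ((m : ℝ) - 1) / 2 + ((d : ℝ) + 1 - 1) / 2 by ring,
    Real.rpow_add (by norm_num), Real.rpow_add (by norm_num), Real.rpow_one]
  field_simp

theorem Gamma_add_nat_mul_le {x y : ℝ} (hy : 0 < y) (hxy : y ≤ x) (n : ℕ) :
    Real.Gamma (y + n) * Real.Gamma x ≤ Real.Gamma (x + n) * Real.Gamma y := by
  have hx : 0 < x := hy.trans_le hxy
  induction n with
  | zero => simp [mul_comm]
  | succ n ih =>
    have e : ∀ z : ℝ, 0 < z → Real.Gamma (z + (n + 1 : ℕ)) = (z + n) * Real.Gamma (z + n) := by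
      intro z hz
      rw [← Real.Gamma_add_one (by positivity)]
      push_cast
      ring_nf
    rw [e x hx, e y hy, mul_assoc, mul_assoc]
    have := Real.Gamma_pos_of_pos hx
    have := Real.Gamma_pos_of_pos (s := y + n) (by positivity)
    exact mul_le_mul (by linarith) ih (by positivity) (by positivity)

theorem sq_Gamma_add_half_le {x : ℝ} (hx : 0 < x) :
    Real.Gamma (x + 1 / 2) ^ 2 ≤ x * Real.Gamma x ^ 2 := by
  have h := Real.Gamma_mul_add_mul_le_rpow_Gamma_mul_rpow_Gamma (s := x) (t := x + 1)
    (a := 1 / 2) (b := 1 / 2) hx (by positivity) (by norm_num) (by norm_num) (by norm_num)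
  have g := Real.Gamma_pos_of_pos hx
  rw [show 1 / 2 * x + 1 / 2 * (x + 1) = x + 1 / 2 by ring, Real.Gamma_add_one hx.ne',
    ← Real.mul_rpow g.le (by positivity), ← Real.sqrt_eq_rpow] at h
  have h3 := Real.Gamma_pos_of_pos (s := x + 1 / 2) (by positivity)
  have h2 := pow_le_pow_left₀ h3.le h 2
  rw [Real.sq_sqrt (by positivity)] at h2
  linarith

theorem momentRatio_pos (d k : ℕ) : 0 < momentRatio d k := by
  have g1 := Real.Gamma_pos_of_pos (s := (d : ℝ) / 2 + 1) (by positivity)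
  have g2 := Real.Gamma_pos_of_pos (s := ((d : ℝ) + 1) * (d + k) / 2 + 1) (by positivity)
  have g3 := Real.Gamma_pos_of_pos (s := ((d : ℝ) + k) / 2 + 1) (by positivity)
  have g4 := Real.Gamma_pos_of_pos (s := (d : ℝ) * (d + k + 1) / 2 + 1) (by positivity)
  unfold momentRatio
  positivity

theorem momentRatio_zero (d : ℕ) : momentRatio d 0 = 1 := by
  have g1 := Real.Gamma_pos_of_pos (s := (d : ℝ) / 2 + 1) (by positivity)
  have g2 := Real.Gamma_pos_of_pos (s := (d : ℝ) * (d + 1) / 2 + 1) (by positivity)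
  rw [momentRatio, Nat.cast_zero, add_zero, mul_comm ((d : ℝ) + 1)]
  field_simp

theorem momentRatio_add_two (d k : ℕ) :
    ((d : ℝ) + 1) * momentRatio d k ≤ momentRatio d (k + 2) := by
  have g1 := Real.Gamma_pos_of_pos (s := (d : ℝ) / 2 + 1) (by positivity)
  have g2 := Real.Gamma_pos_of_pos (s := ((d : ℝ) + 1) * (d + k) / 2 + 1) (by positivity)
  have g3 := Real.Gamma_pos_of_pos (s := ((d : ℝ) + k) / 2 + 1) (by positivity)
  have g4 := Real.Gamma_pos_of_pos (s := (d : ℝ) * (d + k + 1) / 2 + 1) (by positivity)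
  have g5 := Real.Gamma_pos_of_pos (s := (d : ℝ) * (d + k + 1) / 2 + 1 + d) (by positivity)
  have h := Gamma_add_nat_mul_le (x := ((d : ℝ) + 1) * (d + k) / 2 + 1)
    (y := (d : ℝ) * (d + k + 1) / 2 + 1) (by positivity)
    (by have : (0 : ℝ) ≤ k := by positivity
        linarith) d
  have e1 : Real.Gamma (((d : ℝ) + 1) * (d + (k + 2 : ℕ)) / 2 + 1) =
      (((d : ℝ) + 1) * (((d : ℝ) + k) / 2 + 1)) *
        Real.Gamma (((d : ℝ) + 1) * (d + k) / 2 + 1 + d) := by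
    rw [show ((d : ℝ) + 1) * (((d : ℝ) + k) / 2 + 1) = ((d : ℝ) + 1) * (d + k) / 2 + 1 + d by ring,
      ← Real.Gamma_add_one (by positivity)]
    push_cast
    ring_nf
  have e2 : Real.Gamma (((d : ℝ) + (k + 2 : ℕ)) / 2 + 1) =
      (((d : ℝ) + k) / 2 + 1) * Real.Gamma (((d : ℝ) + k) / 2 + 1) := by
    rw [← Real.Gamma_add_one (by positivity)]
    push_cast
    ring_nf
  have e3 : (d : ℝ) * (d + (k + 2 : ℕ) + 1) / 2 + 1 = (d : ℝ) * (d + k + 1) / 2 + 1 + d := by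
    push_cast; ring
  rw [momentRatio, momentRatio, e1, e2, e3, mul_div_assoc', div_le_div_iff₀ (by positivity)
    (by positivity)]
  have hk : (0 : ℝ) ≤ ((d : ℝ) + k) / 2 + 1 := by positivity
  have key := mul_le_mul_of_nonneg_left h (show 0 ≤ ((d : ℝ) + 1) * (((d : ℝ) + k) / 2 + 1) *
    (Real.Gamma ((d : ℝ) / 2 + 1) * Real.Gamma (((d : ℝ) + k) / 2 + 1)) by positivity)
  linarith [key]

theorem two_lt_momentRatio_one (hd : 4 ≤ d) : 2 < momentRatio d 1 := by
  have hd' : (4 : ℝ) ≤ d := by exact_mod_cast hd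
  have g1 := Real.Gamma_pos_of_pos (s := (d : ℝ) / 2 + 1) (by positivity)
  have g3 := Real.Gamma_pos_of_pos (s := (d : ℝ) / 2 + 1 + 1 / 2) (by positivity)
  have g4 := Real.Gamma_pos_of_pos (s := ((d : ℝ) + 1) ^ 2 / 2) (by positivity)
  have g5 := Real.Gamma_pos_of_pos (s := ((d : ℝ) + 1) ^ 2 / 2 + 1 / 2) (by positivity)
  have g6 := Real.Gamma_pos_of_pos (s := ((d : ℝ) + 1) ^ 2 / 2 + 1) (by positivity)
  have h1 := sq_Gamma_add_half_le (x := (d : ℝ) / 2 + 1) (by positivity)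
  have h2 := sq_Gamma_add_half_le (x := ((d : ℝ) + 1) ^ 2 / 2) (by positivity)
  have h3 := Real.Gamma_add_one (s := ((d : ℝ) + 1) ^ 2 / 2) (by positivity)
  rw [momentRatio, Nat.cast_one,
    show ((d : ℝ) + 1) * (d + 1) / 2 + 1 = ((d : ℝ) + 1) ^ 2 / 2 + 1 by ring,
    show ((d : ℝ) + 1) / 2 + 1 = (d : ℝ) / 2 + 1 + 1 / 2 by ring,
    show (d : ℝ) * (d + 1 + 1) / 2 + 1 = ((d : ℝ) + 1) ^ 2 / 2 + 1 / 2 by ring,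
    lt_div_iff₀ (by positivity), h3]
  refine lt_of_pow_lt_pow_left₀ 2 (by positivity) ?_
  set u := (d : ℝ) / 2 + 1
  set v := ((d : ℝ) + 1) ^ 2 / 2
  have hu : 0 < u := by positivity
  have hv : 0 < v := by positivity
  have huv : 4 * u < v := by simp only [u, v]; nlinarith
  calc (2 * (Real.Gamma (u + 1 / 2) * Real.Gamma (v + 1 / 2))) ^ 2
      = 4 * (Real.Gamma (u + 1 / 2) ^ 2 * Real.Gamma (v + 1 / 2) ^ 2) := by ring
    _ ≤ 4 * ((u * Real.Gamma u ^ 2) * (v * Real.Gamma v ^ 2)) := by gcongr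
    _ = (4 * u) * (v * (Real.Gamma u * Real.Gamma v) ^ 2) := by ring
    _ < v * (v * (Real.Gamma u * Real.Gamma v) ^ 2) := by gcongr
    _ = _ := by ring

theorem exists_pow_le_simplexMoment (hd : 4 ≤ d) :
    ∃ ρ : ℝ, 1 < ρ ∧ ∀ k : ℕ, 1 ≤ k → ENNReal.ofReal ((2 * ρ) ^ k) *
      (ballVol d * detMoment ballWeight d k) ≤ simplexMoment ballWeight d k := by
  have hd' : (4 : ℝ) ≤ d := by exact_mod_cast hd
  set σ := min √(d + 1 : ℝ) (momentRatio d 1)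
  have hσ2 : 2 < σ := lt_min (by rw [Real.lt_sqrt (by norm_num)]; linarith)
    (two_lt_momentRatio_one hd)
  have hσ0 : 0 ≤ σ := by linarith
  have hσsq : σ ^ 2 ≤ d + 1 := by
    have := pow_le_pow_left₀ hσ0 (min_le_left √(d + 1 : ℝ) (momentRatio d 1)) 2
    rwa [Real.sq_sqrt (by positivity)] at this
  have hpow : ∀ k : ℕ, σ ^ k ≤ momentRatio d k ∧ σ ^ (k + 1) ≤ momentRatio d (k + 1) := by
    intro k
    induction k with
    | zero =>
      refine ⟨by simp [momentRatio_zero], ?_⟩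
      rw [zero_add, pow_one]
      exact min_le_right _ _
    | succ k ih =>
      refine ⟨ih.2, ?_⟩
      calc σ ^ (k + 1 + 1) = σ ^ 2 * σ ^ k := by ring
        _ ≤ (d + 1) * momentRatio d k := by
          have := momentRatio_pos d k
          exact mul_le_mul hσsq ih.1 (by positivity) (by positivity)
        _ ≤ _ := momentRatio_add_two d k
  refine ⟨σ / 2, by linarith, fun k hk => ?_⟩
  rw [simplexMoment_ballWeight (by omega) hk, mul_div_cancel₀ _ two_ne_zero]
  gcongr
  exact (hpow k).1

theorem lintegral_fin_cons_symm {n : ℕ} {φ : (Fin (n + 1) → ℝ) → ℝ≥0∞} (hφ : Measurable φ) :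
    ∫⁻ x, φ x = ∫⁻ w : Fin n → ℝ, ∫⁻ a : ℝ, φ (Fin.cons a w) := by
  have h : Measurable (Function.uncurry fun (a : ℝ) (w : Fin n → ℝ) => φ (Fin.cons a w)) :=
    hφ.comp measurable_fin_cons
  rw [lintegral_fin_cons hφ]
  exact lintegral_lintegral_swap h.aemeasurable

theorem lintegral_shear [NeZero d] {m : (Fin d → ℝ) → ℝ} (hm : Measurable m)
    (hm0 : ∀ x r, m (Function.update x 0 r) = m x) {F : (Fin d → ℝ) → ℝ≥0∞} (hF : Measurable F) :
    ∫⁻ x, F x = ∫⁻ x, F (x + Pi.single 0 (m x)) := by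
  obtain ⟨e, rfl⟩ := Nat.exists_eq_succ_of_ne_zero (NeZero.ne d)
  have hs : Measurable fun x : Fin (e + 1) → ℝ => F (x + Pi.single 0 (m x)) := by
    refine hF.comp (measurable_id.add (measurable_pi_iff.2 fun i => ?_))
    by_cases hi : i = 0
    · subst hi; simpa using hm
    · simp [hi]
  rw [lintegral_fin_cons_symm hF, lintegral_fin_cons_symm hs]
  congr 1
  funext w
  have h : ∀ a : ℝ, (Fin.cons a w + Pi.single 0 (m (Fin.cons a w)) : Fin (e + 1) → ℝ) =
      Fin.cons (a + m (Fin.cons 0 w)) w := by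
    intro a
    have := hm0 (Fin.cons 0 w) a
    rw [Fin.update_cons_zero] at this
    rw [this]
    funext i
    refine Fin.cases ?_ (fun j => ?_) i <;> simp
  simp_rw [h]
  exact (lintegral_add_right_eq_self (fun a : ℝ => F (Fin.cons a w)) _).symm

/-- The map scaling the zeroth coordinate by `r` and the other coordinates by `t`. -/
def scaleMat [NeZero d] (r t : ℝ) : Matrix (Fin d) (Fin d) ℝ :=
  Matrix.diagonal fun i => if i = 0 then r else t

theorem scaleMat_mulVec [NeZero d] (r t : ℝ) (x : Fin d → ℝ) :
    (scaleMat r t).mulVec x = Function.update (t • x) 0 (r * x 0) := by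
  funext i
  rw [scaleMat, Matrix.mulVec_diagonal]
  by_cases hi : i = 0
  · subst hi; simp
  · simp [hi]

theorem det_scaleMat [NeZero d] (r t : ℝ) :
    (scaleMat r t : Matrix (Fin d) (Fin d) ℝ).det = r * t ^ (d - 1) := by
  rw [scaleMat, Matrix.det_diagonal, Finset.prod_ite, Finset.filter_eq', Finset.filter_ne']
  simp

theorem nsq_update_zero [NeZero d] (x : Fin d → ℝ) (r : ℝ) :
    nsq (Function.update x 0 r) = nsq x - x 0 ^ 2 + r ^ 2 := by
  simp only [nsq_eq]
  rw [← Finset.add_sum_erase _ _ (Finset.mem_univ (0 : Fin d)),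
    ← Finset.add_sum_erase _ (fun i => x i ^ 2) (Finset.mem_univ (0 : Fin d))]
  have : ∀ i ∈ Finset.univ.erase (0 : Fin d), Function.update x 0 r i ^ 2 = x i ^ 2 := by
    intro i hi
    rw [Function.update_of_ne (Finset.ne_of_mem_erase hi)]
  rw [Finset.sum_congr rfl this, Function.update_self]
  ring

theorem sdet_add_single [NeZero d] (μ : Fin (d + 1) → ℝ) (y : Fin (d + 1) → Fin d → ℝ) :
    sdet (fun i => y i + Pi.single 0 (μ i)) =
      sdet y + ((aug 1 y).updateCol (Fin.succ 0) μ).det := by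
  have h : aug 1 (fun i => y i + Pi.single 0 (μ i)) =
      (aug 1 y).updateCol (Fin.succ 0) ((fun i => y i 0) + μ) := by
    ext i j
    refine Fin.cases ?_ (fun j => ?_) j
    · rw [Matrix.updateCol_ne (Fin.succ_ne_zero _).symm]; simp
    · by_cases hj : j = 0
      · subst hj
        simp only [Matrix.updateCol_self, aug_succ, Pi.add_apply, Pi.single_eq_same]
      · rw [Matrix.updateCol_ne fun h => hj (Fin.succ_injective _ h)]; simp [hj]
  have h' : (aug 1 y).updateCol (Fin.succ 0) (fun i => y i 0) = aug 1 y :=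
    Matrix.updateCol_eq_self (aug 1 y) (Fin.succ 0)
  rw [sdet, h, Matrix.det_updateCol_add, h', sdet]

theorem updateCol_aug_update [NeZero d] (μ : Fin (d + 1) → ℝ) (y : Fin (d + 1) → Fin d → ℝ)
    (r : Fin (d + 1) → ℝ) :
    (aug 1 fun i => Function.update (y i) 0 (r i)).updateCol (Fin.succ 0) μ =
      (aug 1 y).updateCol (Fin.succ 0) μ := by
  ext i j
  refine Fin.cases ?_ (fun j => ?_) j
  · rw [Matrix.updateCol_ne (Fin.succ_ne_zero _).symm,
      Matrix.updateCol_ne (Fin.succ_ne_zero _).symm]; simp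
  · by_cases hj : j = 0
    · subst hj; simp only [Matrix.updateCol_self]
    · have hj' : j.succ ≠ Fin.succ 0 := fun h => hj (Fin.succ_injective _ h)
      rw [Matrix.updateCol_ne hj', Matrix.updateCol_ne hj']
      simp [hj]

theorem two_mul_enorm_pow_le (a b : ℝ) {k : ℕ} (hk : 1 ≤ k) :
    2 * ‖a‖ₑ ^ k ≤ ‖a + b‖ₑ ^ k + ‖-a + b‖ₑ ^ k := by
  have h : 2 * |a| ^ k ≤ |a + b| ^ k + |-a + b| ^ k := by
    have h1 := add_pow_le (abs_nonneg (a + b)) (abs_nonneg (-a + b)) k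
    have h2 : 2 * |a| ≤ |a + b| + |-a + b| := by
      rw [show 2 * |a| = |(a + b) - (-a + b)| by
        rw [show (a + b) - (-a + b) = 2 * a by ring, abs_mul, abs_two]]
      exact abs_sub _ _
    have h3 := (pow_le_pow_left₀ (by positivity) h2 k).trans h1
    rw [mul_pow, show (2 : ℝ) ^ k = 2 ^ (k - 1) * 2 by rw [← pow_succ, Nat.sub_add_cancel hk],
      mul_assoc] at h3
    exact le_of_mul_le_mul_left h3 (by positivity)
  simp only [← ofReal_norm, Real.norm_eq_abs]
  rw [← ENNReal.ofReal_pow (abs_nonneg _), ← ENNReal.ofReal_pow (abs_nonneg _),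
    ← ENNReal.ofReal_pow (abs_nonneg _), ← ENNReal.ofReal_add (by positivity) (by positivity),
    show (2 : ℝ≥0∞) = ENNReal.ofReal 2 by simp, ← ENNReal.ofReal_mul (by norm_num)]
  exact ENNReal.ofReal_le_ofReal h

/-- `∫ |sdet y| ^ k` over all `y` with rows in `A`. -/
noncomputable def setMoment (A : Set (Fin d → ℝ)) (k : ℕ) : ℝ≥0∞ :=
  ∫⁻ y : Fin (d + 1) → Fin d → ℝ, ‖sdet y‖ₑ ^ k * ∏ i, A.indicator 1 (y i)

theorem measurable_sdet_weight {A : Set (Fin d → ℝ)} (hA : MeasurableSet A) (k : ℕ) :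
    Measurable fun y : Fin (d + 1) → Fin d → ℝ =>
      ‖sdet y‖ₑ ^ k * ∏ i, A.indicator (1 : (Fin d → ℝ) → ℝ≥0∞) (y i) := by
  have h1 : Measurable fun y : Fin (d + 1) → Fin d → ℝ => ‖sdet y‖ₑ ^ k :=
    measurable_sdet.enorm.pow_const k
  have h2 : Measurable (A.indicator (1 : (Fin d → ℝ) → ℝ≥0∞)) := measurable_one.indicator hA
  exact h1.mul (Finset.measurable_prod _ fun i _ => h2.comp (measurable_pi_apply i))

theorem setMoment_le_of_shear [NeZero d] {m : (Fin d → ℝ) → ℝ} (hm : Measurable m)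
    (hm0 : ∀ x r, m (Function.update x 0 r) = m x) {S A : Set (Fin d → ℝ)}
    (hS : MeasurableSet S) (hA : MeasurableSet A)
    (hsymm : ∀ x, Function.update x 0 (-x 0) ∈ S ↔ x ∈ S)
    (hSA : ∀ x ∈ S, x + Pi.single 0 (m x) ∈ A) {k : ℕ} (hk : 1 ≤ k) :
    setMoment S k ≤ setMoment A k := by
  have hΦ : Measurable fun x : Fin d → ℝ => x + Pi.single 0 (m x) := by
    refine measurable_id.add (measurable_pi_iff.2 fun i => ?_)
    by_cases hi : i = 0
    · subst hi; simpa using hm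
    · simp [hi]
  have hwS : Measurable (S.indicator (1 : (Fin d → ℝ) → ℝ≥0∞)) := measurable_one.indicator hS
  set G : (Fin (d + 1) → Fin d → ℝ) → ℝ≥0∞ := fun y =>
    ‖sdet fun i => y i + Pi.single 0 (m (y i))‖ₑ ^ k * ∏ i, S.indicator 1 (y i) with hG
  have hGm : Measurable G := by
    have h1 : Measurable fun y : Fin (d + 1) → Fin d → ℝ =>
        ‖sdet fun i => y i + Pi.single 0 (m (y i))‖ₑ ^ k :=
      (measurable_sdet.comp (measurable_pi_iff.2 fun i =>
        hΦ.comp (measurable_pi_apply i))).enorm.pow_const k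
    exact h1.mul (Finset.measurable_prod _ fun i _ => hwS.comp (measurable_pi_apply i))
  have hGA : ∫⁻ y, G y ≤ setMoment A k := by
    have h := lintegral_pi_comp (n := d + 1) hΦ (c := 1)
      (fun g hg => by rw [one_mul]; exact lintegral_shear hm hm0 hg) (measurable_sdet_weight hA k)
    rw [setMoment, h, one_pow, one_mul]
    refine lintegral_mono fun y => mul_le_mul_right (Finset.prod_le_prod' fun i _ => ?_) _
    by_cases hi : y i ∈ S
    · simp [hi, hSA _ hi]
    · simp [hi]
  have hdet : (scaleMat (-1) 1 : Matrix (Fin d) (Fin d) ℝ).det = -1 := by simp [det_scaleMat]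
  have hR : ∀ x : Fin d → ℝ, (scaleMat (-1) 1).mulVec x = Function.update x 0 (-x 0) := by
    intro x; rw [scaleMat_mulVec]; simp
  have hGR : ∫⁻ y, G y = ∫⁻ y : Fin (d + 1) → Fin d → ℝ,
      G fun i => (scaleMat (-1) 1).mulVec (y i) := by
    have h := lintegral_pi_comp (n := d + 1) (E := Fin d → ℝ)
      (Φ := fun x => (scaleMat (-1) 1).mulVec x) (by fun_prop) (c := 1)
      (fun g hg => by
        have := lintegral_eq_lintegral_mulVec (M := scaleMat (-1) 1) (by rw [hdet]; norm_num) hg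
        simpa [hdet] using this) hGm
    simpa using h
  have h2 : 2 * setMoment S k ≤ 2 * ∫⁻ y, G y := by
    rw [two_mul (∫⁻ y, G y)]
    nth_rewrite 2 [hGR]
    rw [← lintegral_add_left hGm, setMoment, ← lintegral_const_mul' _ _ (by simp)]
    refine lintegral_mono fun y => ?_
    have e1 : sdet (fun i => Function.update (y i) 0 (-y i 0)) = -sdet y := by
      have := sdet_affine (scaleMat (-1) 1) 0 y
      simpa [hR, hdet] using this
    simp only [hG, hR, hm0]
    have hprod : ∏ i, S.indicator (1 : (Fin d → ℝ) → ℝ≥0∞) (Function.update (y i) 0 (-y i 0)) =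
        ∏ i, S.indicator 1 (y i) := by
      refine Finset.prod_congr rfl fun i _ => ?_
      by_cases hi : y i ∈ S
      · simp [hi, (hsymm _).2 hi]
      · simp [hi, mt (hsymm _).1 hi]
    rw [hprod, sdet_add_single, sdet_add_single _ fun i => Function.update (y i) 0 (-y i 0),
      updateCol_aug_update, e1, ← add_mul, ← mul_assoc]
    exact mul_le_mul_left (two_mul_enorm_pow_le _ _ hk) _
  exact ((ENNReal.mul_le_mul_iff_right two_ne_zero (by simp)).1 h2).trans hGA

/-- The part of the unit ball in a cone of directions around the zeroth axis, above height `τ`. -/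
def truncCone (d : ℕ) [NeZero d] (δ τ : ℝ) : Set (Fin d → ℝ) :=
  {x | nsq x ≤ 1 ∧ δ * √(nsq x) ≤ x 0 ∧ τ ≤ x 0}

theorem isClosed_truncCone [NeZero d] (δ τ : ℝ) : IsClosed (truncCone d δ τ) := by
  have h := continuous_nsq (d := d)
  refine (isClosed_le h continuous_const).inter ((isClosed_le ?_ (continuous_apply 0)).inter
    (isClosed_le continuous_const (continuous_apply 0)))
  exact continuous_const.mul h.sqrt

theorem measurableSet_truncCone [NeZero d] (δ τ : ℝ) : MeasurableSet (truncCone d δ τ) :=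
  (isClosed_truncCone δ τ).measurableSet

/-- The ellipsoid `4 x₀² + |x'|² < t²`, where `x'` collects the coordinates of `x` other than
`x₀`. -/
def flatEllipsoid (d : ℕ) [NeZero d] (t : ℝ) : Set (Fin d → ℝ) := {x | nsq x + 3 * x 0 ^ 2 < t ^ 2}

theorem measurableSet_flatEllipsoid [NeZero d] (t : ℝ) : MeasurableSet (flatEllipsoid d t) := by
  have h := continuous_nsq (d := d)
  exact (isOpen_lt (h.add (by fun_prop)) continuous_const).measurableSet

theorem setMoment_flatEllipsoid [NeZero d] {t : ℝ} (ht : 0 < t) (k : ℕ) :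
    setMoment (flatEllipsoid d t) k =
      ENNReal.ofReal ((t ^ d / 2) ^ (k + d + 1)) * simplexMoment ballWeight d k := by
  have hd : 0 < d := NeZero.pos d
  have hdet : (scaleMat (t / 2) t : Matrix (Fin d) (Fin d) ℝ).det = t ^ d / 2 := by
    rw [det_scaleMat, div_mul_eq_mul_div, ← pow_succ', Nat.sub_add_cancel hd]
  have hdet0 : 0 < t ^ d / 2 := by positivity
  have h := lintegral_pi_comp (n := d + 1) (E := Fin d → ℝ)
    (Φ := fun x => (scaleMat (t / 2) t).mulVec x) (by fun_prop) (fun g hg =>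
      lintegral_eq_lintegral_mulVec (by rw [hdet]; exact hdet0.ne') hg)
    (measurable_sdet_weight (measurableSet_flatEllipsoid (d := d) t) k)
  have hw : ∀ x : Fin d → ℝ, (flatEllipsoid d t).indicator (1 : (Fin d → ℝ) → ℝ≥0∞)
      ((scaleMat (t / 2) t).mulVec x) = ballWeight (nsq x) := by
    intro x
    have hiff : (scaleMat (t / 2) t).mulVec x ∈ flatEllipsoid d t ↔ nsq x < 1 := by
      rw [scaleMat_mulVec, flatEllipsoid, Set.mem_ofPred_eq, nsq_update_zero, nsq_smul,
        Function.update_self, Pi.smul_apply, smul_eq_mul]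
      rw [show t ^ 2 * nsq x - (t * x 0) ^ 2 + (t / 2 * x 0) ^ 2 + 3 * (t / 2 * x 0) ^ 2 =
        t ^ 2 * nsq x by ring]
      exact mul_lt_iff_lt_one_right (by positivity)
    by_cases hx : nsq x < 1
    · simp [hiff.2 hx, ballWeight, hx]
    · simp [mt hiff.1 hx, ballWeight, hx]
  have hs : ∀ y : Fin (d + 1) → Fin d → ℝ,
      sdet (fun i => (scaleMat (t / 2) t).mulVec (y i)) = t ^ d / 2 * sdet y := by
    intro y
    simpa [hdet] using sdet_affine (scaleMat (t / 2) t) 0 y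
  have hn : ‖t ^ d / 2‖ₑ = ENNReal.ofReal (t ^ d / 2) := Real.enorm_of_nonneg hdet0.le
  simp only [hw, hs, hdet, enorm_mul, mul_pow, mul_assoc, hn] at h
  rw [lintegral_const_mul' _ _ (ENNReal.pow_ne_top ENNReal.ofReal_ne_top), ← mul_assoc,
    ← pow_add] at h
  rw [setMoment, h, ENNReal.ofReal_pow hdet0.le, simplexMoment,
    show k + d + 1 = d + 1 + k by ring]

theorem le_setMoment_truncCone [NeZero d] {t τ : ℝ} (ht : 0 < t) (ht1 : t < 1) (hτ : τ ≤ 1 - t)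
    {k : ℕ} (hk : 1 ≤ k) :
    ENNReal.ofReal ((t ^ d / 2) ^ (k + d + 1)) * simplexMoment ballWeight d k ≤
      setMoment (truncCone d (1 - t) τ) k := by
  rw [← setMoment_flatEllipsoid ht]
  refine setMoment_le_of_shear
    (m := fun x => √(t ^ 2 - (nsq x - x 0 ^ 2)) / 2 + (1 - t)) ?_ ?_
    (measurableSet_flatEllipsoid t) (measurableSet_truncCone _ _) ?_ ?_ hk
  · have := measurable_nsq (d := d)
    fun_prop
  · intro x r
    simp [nsq_update_zero]
  · intro x
    simp [flatEllipsoid, nsq_update_zero]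
  · intro x hx
    have hx' : nsq x + 3 * x 0 ^ 2 < t ^ 2 := hx
    have hq : 0 ≤ nsq x - x 0 ^ 2 := by
      have := nsq_nonneg (Function.update x 0 0)
      rw [nsq_update_zero] at this
      linarith
    have hsum : x + Pi.single 0 (√(t ^ 2 - (nsq x - x 0 ^ 2)) / 2 + (1 - t)) =
        Function.update x 0 (x 0 + (√(t ^ 2 - (nsq x - x 0 ^ 2)) / 2 + (1 - t))) := by
      funext i
      by_cases hi : i = 0
      · subst hi; simp
      · simp [hi]
    rw [hsum]
    have hr0 := Real.sqrt_nonneg (t ^ 2 - (nsq x - x 0 ^ 2))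
    have hr2 := Real.sq_sqrt (show 0 ≤ t ^ 2 - (nsq x - x 0 ^ 2) by nlinarith)
    set r := √(t ^ 2 - (nsq x - x 0 ^ 2))
    have habs : |x 0| ≤ r / 2 :=
      abs_le_of_sq_le_sq (by rw [div_pow]; linarith) (by positivity)
    have hrt : r ≤ t := le_of_sq_le_sq (by linarith) ht.le
    obtain ⟨h1, h2⟩ := abs_le.1 habs
    have hn : nsq (Function.update x 0 (x 0 + (r / 2 + (1 - t)))) ≤ 1 := by
      rw [nsq_update_zero]
      have : (x 0 + (r / 2 + (1 - t))) ^ 2 ≤ (r + (1 - t)) ^ 2 :=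
        pow_le_pow_left₀ (by linarith) (by linarith) 2
      nlinarith
    refine ⟨hn, ?_, ?_⟩
    · rw [Function.update_self]
      have : √(nsq (Function.update x 0 (x 0 + (r / 2 + (1 - t))))) ≤ 1 := by
        rw [Real.sqrt_le_one]; exact hn
      nlinarith
    · rw [Function.update_self]; linarith

theorem setLIntegral_univ_pi {E : Type*} [MeasureSpace E] [SigmaFinite (volume : Measure E)] {n : ℕ}
    {A : Fin n → Set E} (hA : ∀ i, MeasurableSet (A i)) (φ : (Fin n → E) → ℝ≥0∞) :
    ∫⁻ y in Set.univ.pi A, φ y = ∫⁻ y, φ y * ∏ i, (A i).indicator 1 (y i) := by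
  rw [← lintegral_indicator (MeasurableSet.univ_pi hA)]
  congr 1
  funext y
  by_cases hy : y ∈ Set.univ.pi A
  · have : ∀ i, (A i).indicator (1 : E → ℝ≥0∞) (y i) = 1 := fun i => by
      simp [hy i (Set.mem_univ i)]
    simp [hy, this]
  · obtain ⟨i, hi⟩ : ∃ i, y i ∉ A i := by simpa [Set.mem_pi] using hy
    rw [Set.indicator_of_notMem hy, Finset.prod_eq_zero (Finset.mem_univ i) (by simp [hi]),
      mul_zero]

theorem norm_toLp_sq (x : Fin d → ℝ) : ‖WithLp.toLp 2 x‖ ^ 2 = nsq x := by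
  rw [EuclideanSpace.norm_sq_eq, nsq_eq]
  simp

/-- The closed Euclidean unit ball of `Fin d → ℝ`. -/
def unitBall (d : ℕ) : Set (Fin d → ℝ) := {x | nsq x ≤ 1}

theorem isCompact_unitBall : IsCompact (unitBall d) := by
  refine Metric.isCompact_of_isClosed_isBounded (isClosed_le continuous_nsq continuous_const)
    (Metric.isBounded_closedBall (x := 0) (r := 1) |>.subset fun x hx => ?_)
  rw [mem_closedBall_zero_iff]
  exact (sq_le_one_iff₀ (norm_nonneg x)).1 ((sq_norm_le_nsq x).trans hx)

theorem measurableSet_unitBall : MeasurableSet (unitBall d) := isCompact_unitBall.measurableSet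

theorem unitBall_ae_eq : unitBall d =ᵐ[volume] {x | nsq x < 1} := by
  have h0 : volume {x : Fin d → ℝ | nsq x = 1} = 0 := by
    have h := (PiLp.volume_preserving_toLp (Fin d)).measure_preimage
      (Metric.isClosed_sphere (x := (0 : EuclideanSpace ℝ (Fin d))) (ε := 1)).nullMeasurableSet
    rw [Measure.addHaar_sphere_of_ne_zero _ _ one_ne_zero] at h
    rw [← h]
    congr 1
    ext x
    rw [Set.mem_preimage, mem_sphere_zero_iff_norm, ← pow_eq_one_iff_of_nonneg (norm_nonneg _)
      two_ne_zero, norm_toLp_sq]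
    rfl
  filter_upwards [measure_eq_zero_iff_ae_notMem.1 h0] with x hx
  have hx' : nsq x ≠ 1 := hx
  exact propext ⟨fun h => lt_of_le_of_ne h hx', fun h => le_of_lt h⟩

theorem volume_unitBall : volume (unitBall d) = ballVol d := by
  rw [measure_congr unitBall_ae_eq, ballVol,
    ← lintegral_indicator_one (measurableSet_lt measurable_nsq measurable_const)]
  congr 1

theorem setLIntegral_unitBall {n : ℕ} (φ : (Fin n → Fin d → ℝ) → ℝ≥0∞) :
    ∫⁻ y in Set.univ.pi fun _ => unitBall d, φ y = ∫⁻ y, φ y * ∏ i, ballWeight (nsq (y i)) := by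
  have h : (Set.univ.pi fun _ : Fin n => unitBall d) =ᵐ[volume]
      Set.univ.pi fun _ => {x | nsq x < 1} :=
    Measure.ae_eq_set_pi fun i _ => unitBall_ae_eq
  rw [setLIntegral_congr h,
    setLIntegral_univ_pi fun _ => measurableSet_lt measurable_nsq measurable_const]
  congr 1

/-- The half of the unit ball where the zeroth coordinate is nonnegative. -/
def halfBall (d : ℕ) [NeZero d] : Set (Fin d → ℝ) := {x | nsq x ≤ 1 ∧ 0 ≤ x 0}

theorem measurableSet_halfBall [NeZero d] : MeasurableSet (halfBall d) :=
  measurableSet_unitBall.inter (measurableSet_le measurable_const (measurable_pi_apply 0))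

theorem setLIntegral_unitBall_eq_two_mul [NeZero d] {u : (Fin d → ℝ) → ℝ≥0∞}
    (hu : ∀ x, u (-x) = u x) :
    ∫⁻ x in unitBall d, u x = 2 * ∫⁻ x in halfBall d, u x := by
  have hH : MeasurableSet {x : Fin d → ℝ | 0 ≤ x 0} :=
    measurableSet_le measurable_const (measurable_pi_apply 0)
  have h0 : volume {x : Fin d → ℝ | x 0 = 0} = 0 := Measure.pi_hyperplane _ _ _
  have hneg : ∫⁻ x in unitBall d \ {x | 0 ≤ x 0}, u x = ∫⁻ x in halfBall d, u x := by
    rw [← lintegral_indicator (measurableSet_unitBall.diff hH),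
      ← lintegral_indicator measurableSet_halfBall, ← lintegral_neg_eq_self]
    refine lintegral_congr_ae ?_
    filter_upwards [measure_eq_zero_iff_ae_notMem.1 h0] with x hx
    have hx' : x 0 ≠ 0 := hx
    have hiff : -x ∈ unitBall d \ {x | 0 ≤ x 0} ↔ x ∈ halfBall d := by
      have hn : nsq (-x) = nsq x := by simp [nsq]
      simp only [unitBall, halfBall, Set.mem_sdiff, Set.mem_ofPred_eq, hn, Pi.neg_apply, not_le]
      exact and_congr_right fun _ => ⟨fun h => by linarith, fun h => by
        have := lt_of_le_of_ne h hx'.symm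
        linarith⟩
    by_cases h : x ∈ halfBall d
    · simp [h, hiff.2 h, hu]
    · simp [h, mt hiff.1 h]
  rw [← lintegral_inter_add_sdiff _ (unitBall d) hH, hneg, two_mul]
  rfl

theorem ballVol_eq_two_mul [NeZero d] : ballVol d = 2 * volume (halfBall d) := by
  rw [← volume_unitBall]
  simpa using setLIntegral_unitBall_eq_two_mul (d := d) (u := fun _ => 1) fun _ => rfl

theorem setLIntegral_unitBall_eq_pow_mul [NeZero d] {n : ℕ} {φ : (Fin n → Fin d → ℝ) → ℝ≥0∞}
    (hφ : Measurable φ) (hneg : ∀ i y, φ (Function.update y i (-y i)) = φ y) :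
    ∫⁻ y in Set.univ.pi fun _ => unitBall d, φ y =
      2 ^ n * ∫⁻ y in Set.univ.pi fun _ => halfBall d, φ y := by
  rw [setLIntegral_univ_pi fun _ => measurableSet_unitBall,
    setLIntegral_univ_pi fun _ => measurableSet_halfBall]
  refine lintegral_pi_weight (J := Unit) (T := fun _ x => -x) (a := fun _ => 1) (by simp)
    (measurable_one.indicator measurableSet_unitBall)
    (measurable_one.indicator measurableSet_halfBall) (fun u hu h => ?_) hφ
    (fun _ i y => by rw [one_mul, hneg])
  have key := setLIntegral_unitBall_eq_two_mul (d := d) (u := u) fun x => by simpa using h () x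
  rw [← lintegral_indicator measurableSet_unitBall,
    ← lintegral_indicator measurableSet_halfBall] at key
  have hmul : ∀ (A : Set (Fin d → ℝ)) (x : Fin d → ℝ), u x * A.indicator 1 x = A.indicator u x :=
    fun A x => by by_cases hx : x ∈ A <;> simp [hx]
  simpa only [hmul] using key

theorem integral_add_average_pow_le {Ω : Type*} [MeasurableSpace Ω] {μ : Measure Ω}
    [IsFiniteMeasure μ] [NeZero μ] {f : Ω → ℝ} (hf0 : ∀ x, 0 ≤ f x)
    (hf : ∀ k : ℕ, Integrable (fun x => f x ^ k) μ) {t : ℝ} (ht : 0 < t) (ht1 : t < 1) (k : ℕ) :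
    ∫ x, (f x + (1 - t) * ⨍ z, f z ∂μ) ^ k ∂μ ≤ (t ^ k)⁻¹ * ∫ x, f x ^ k ∂μ := by
  set c := ⨍ z, f z ∂μ with hc
  have hc0 : 0 ≤ c := by
    rw [hc, average_eq, smul_eq_mul]
    exact mul_nonneg (by positivity) (integral_nonneg hf0)
  have hjensen : c ^ k ≤ ⨍ x, f x ^ k ∂μ :=
    (convexOn_pow k).map_average_le (continuousOn_pow k) isClosed_Ici
      (Filter.Eventually.of_forall hf0) (by simpa using hf 1) (hf k)
  have hmass : 0 < μ.real Set.univ := by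
    rw [Measure.real, ENNReal.toReal_pos_iff]
    exact ⟨by simpa [pos_iff_ne_zero] using NeZero.ne μ, measure_lt_top _ _⟩
  have hcint : μ.real Set.univ * c ^ k ≤ ∫ x, f x ^ k ∂μ := by
    rw [average_eq, smul_eq_mul, inv_mul_eq_div, le_div_iff₀ hmass] at hjensen
    linarith
  have hpt : ∀ x, (f x + (1 - t) * c) ^ k ≤ t * (t ^ k)⁻¹ * f x ^ k + (1 - t) * c ^ k := by
    intro x
    have h := (convexOn_pow k).2 (show f x / t ∈ Set.Ici (0 : ℝ) from div_nonneg (hf0 x) ht.le)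
      (show c ∈ Set.Ici (0 : ℝ) from hc0) ht.le (by linarith : 0 ≤ 1 - t) (by ring)
    simp only [smul_eq_mul, div_pow] at h
    rw [mul_div_cancel₀ _ ht.ne'] at h
    refine h.trans (le_of_eq ?_)
    ring
  have hInt : Integrable (fun x => t * (t ^ k)⁻¹ * f x ^ k + (1 - t) * c ^ k) μ :=
    ((hf k).const_mul _).add (integrable_const _)
  calc ∫ x, (f x + (1 - t) * c) ^ k ∂μ
      ≤ ∫ x, (t * (t ^ k)⁻¹ * f x ^ k + (1 - t) * c ^ k) ∂μ :=
        integral_mono_of_nonneg (Filter.Eventually.of_forall fun x =>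
          pow_nonneg (add_nonneg (hf0 x) (mul_nonneg (by linarith) hc0)) k) hInt
          (Filter.Eventually.of_forall hpt)
    _ = t * (t ^ k)⁻¹ * ∫ x, f x ^ k ∂μ + (1 - t) * (μ.real Set.univ * c ^ k) := by
        rw [integral_add ((hf k).const_mul _) (integrable_const _), integral_const_mul,
          integral_const, smul_eq_mul]
        ring
    _ ≤ t * (t ^ k)⁻¹ * ∫ x, f x ^ k ∂μ + (1 - t) * ((t ^ k)⁻¹ * ∫ x, f x ^ k ∂μ) := by
        have hi : 0 ≤ ∫ x, f x ^ k ∂μ := integral_nonneg fun x => pow_nonneg (hf0 x) k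
        have h1 : 1 ≤ (t ^ k)⁻¹ := (one_le_inv₀ (by positivity)).2 (pow_le_one₀ ht.le ht1.le)
        have h2 : μ.real Set.univ * c ^ k ≤ (t ^ k)⁻¹ * ∫ x, f x ^ k ∂μ :=
          hcint.trans (le_mul_of_one_le_left hi h1)
        have := mul_le_mul_of_nonneg_left h2 (by linarith : 0 ≤ 1 - t)
        linarith
    _ = _ := by ring

theorem isCompact_pi_unitBall : IsCompact (Set.univ.pi fun _ : Fin d => unitBall d) :=
  isCompact_univ_pi fun _ => isCompact_unitBall

theorem volume_pi_unitBall_pos (d : ℕ) :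
    0 < volume ((Set.univ.pi fun _ : Fin d => unitBall d) ∩
      {y | (Matrix.of y).det ≠ 0}) := by
  have hopen : IsOpen ((Set.univ.pi fun _ : Fin d => {x : Fin d → ℝ | nsq x < 1}) ∩
      {y | (Matrix.of y).det ≠ 0}) :=
    (isOpen_set_pi Set.finite_univ fun _ _ => isOpen_lt continuous_nsq continuous_const).inter
      (isOpen_ne_fun continuous_det_rows continuous_const)
  refine (hopen.measure_pos volume ⟨fun i => (2⁻¹ : ℝ) • Pi.single i 1, fun i _ => ?_, ?_⟩).trans_le
    (measure_mono (Set.inter_subset_inter_left _ (Set.pi_mono fun _ _ x (hx : nsq x < 1) => hx.le)))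
  · rw [Set.mem_ofPred_eq, nsq_smul]
    norm_num [nsq]
  · have : (Matrix.of fun i => (2⁻¹ : ℝ) • Pi.single i 1 : Matrix (Fin d) (Fin d) ℝ) =
        (2⁻¹ : ℝ) • 1 := by
      ext i j
      simp [Matrix.one_apply, Pi.single_apply, eq_comm]
    rw [Set.mem_ofPred_eq, this, Matrix.det_smul, Matrix.det_one]
    positivity

theorem integrableOn_pi_unitBall {f : (Fin d → Fin d → ℝ) → ℝ} (hf : Continuous f) :
    IntegrableOn f (Set.univ.pi fun _ : Fin d => unitBall d) :=
  hf.continuousOn.integrableOn_compact isCompact_pi_unitBall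

theorem continuous_abs_det_pow (k : ℕ) :
    Continuous fun y : Fin d → Fin d → ℝ => |(Matrix.of y).det| ^ k :=
  continuous_det_rows.abs.pow k

theorem setIntegral_abs_det_pow_pos (k : ℕ) :
    0 < ∫ y in Set.univ.pi fun _ : Fin d => unitBall d, |(Matrix.of y).det| ^ k := by
  rw [setIntegral_pos_iff_support_of_nonneg_ae
    (Filter.Eventually.of_forall fun y => pow_nonneg (abs_nonneg _) k)
    (integrableOn_pi_unitBall (continuous_abs_det_pow k))]
  refine (volume_pi_unitBall_pos d).trans_le (measure_mono fun y hy => ⟨?_, hy.1⟩)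
  exact pow_ne_zero k (abs_ne_zero.2 hy.2)

theorem detMoment_ballWeight (k : ℕ) : detMoment ballWeight d k =
    ENNReal.ofReal (∫ y in Set.univ.pi fun _ : Fin d => unitBall d, |(Matrix.of y).det| ^ k) := by
  rw [detMoment, ← setLIntegral_unitBall, ofReal_integral_eq_lintegral_ofReal
    (integrableOn_pi_unitBall (continuous_abs_det_pow k))
    (Filter.Eventually.of_forall fun y => pow_nonneg (abs_nonneg _) k)]
  simp only [Real.enorm_eq_ofReal_abs, ENNReal.ofReal_pow (abs_nonneg _)]

/-- The mean of `|det|` over matrices whose rows lie in the unit ball. -/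
noncomputable def meanDet (d : ℕ) : ℝ :=
  ⨍ y in Set.univ.pi fun _ : Fin d => unitBall d, |(Matrix.of y).det|

theorem meanDet_pos : 0 < meanDet d := by
  have h := setIntegral_abs_det_pow_pos (d := d) 1
  simp only [pow_one] at h
  rw [meanDet, setAverage_eq, smul_eq_mul]
  refine mul_pos (inv_pos.2 (ENNReal.toReal_pos ?_ isCompact_pi_unitBall.measure_ne_top)) h
  exact ((volume_pi_unitBall_pos d).trans_le (measure_mono Set.inter_subset_left)).ne'

theorem setLIntegral_abs_det_add_pow_le [NeZero d] {t : ℝ} (ht : 0 < t) (ht1 : t < 1) (δ : ℝ)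
    (k : ℕ) :
    2 ^ d * ∫⁻ y in Set.univ.pi fun _ : Fin d => truncCone d δ 0,
        ENNReal.ofReal ((|(Matrix.of y).det| + (1 - t) * meanDet d) ^ k) ≤
      ENNReal.ofReal (t ^ k)⁻¹ * detMoment ballWeight d k := by
  have hcont : Continuous fun y : Fin d → Fin d → ℝ =>
      (|(Matrix.of y).det| + (1 - t) * meanDet d) ^ k :=
    (continuous_det_rows.abs.add continuous_const).pow k
  have hnn : ∀ y : Fin d → Fin d → ℝ, 0 ≤ (|(Matrix.of y).det| + (1 - t) * meanDet d) ^ k :=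
    fun y => pow_nonneg (add_nonneg (abs_nonneg _)
      (mul_nonneg (by linarith) meanDet_pos.le)) k
  have hneg : ∀ (i : Fin d) (y : Fin d → Fin d → ℝ),
      (Matrix.of (Function.update y i (-y i))).det = -(Matrix.of y).det := by
    intro i y
    have := Matrix.det_updateRow_smul (Matrix.of y) i (-1) (y i)
    rw [show (Matrix.of y).updateRow i (y i) = Matrix.of y from
      Matrix.updateRow_eq_self (Matrix.of y) i, neg_one_smul, neg_one_mul] at this
    exact this
  calc _ ≤ 2 ^ d * ∫⁻ y in Set.univ.pi fun _ : Fin d => halfBall d,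
        ENNReal.ofReal ((|(Matrix.of y).det| + (1 - t) * meanDet d) ^ k) := by
        gcongr
        exact fun x hx => ⟨hx.1, hx.2.2⟩
    _ = ∫⁻ y in Set.univ.pi fun _ : Fin d => unitBall d,
        ENNReal.ofReal ((|(Matrix.of y).det| + (1 - t) * meanDet d) ^ k) :=
      (setLIntegral_unitBall_eq_pow_mul hcont.measurable.ennreal_ofReal fun i y => by
        rw [hneg, abs_neg]).symm
    _ = ENNReal.ofReal (∫ y in Set.univ.pi fun _ : Fin d => unitBall d,
        (|(Matrix.of y).det| + (1 - t) * meanDet d) ^ k) :=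
      (ofReal_integral_eq_lintegral_ofReal (integrableOn_pi_unitBall hcont)
        (Filter.Eventually.of_forall hnn)).symm
    _ ≤ ENNReal.ofReal ((t ^ k)⁻¹ * ∫ y in Set.univ.pi fun _ : Fin d => unitBall d,
        |(Matrix.of y).det| ^ k) := by
      have : IsFiniteMeasure (volume.restrict (Set.univ.pi fun _ : Fin d => unitBall d)) :=
        ⟨by rw [Measure.restrict_apply_univ]; exact isCompact_pi_unitBall.measure_lt_top⟩
      have : NeZero (volume.restrict (Set.univ.pi fun _ : Fin d => unitBall d)) :=
        ⟨fun h => ((volume_pi_unitBall_pos d).trans_le (measure_mono Set.inter_subset_left)).ne'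
          (Measure.restrict_eq_zero.1 h)⟩
      exact ENNReal.ofReal_le_ofReal (integral_add_average_pow_le (fun y => abs_nonneg _)
        (fun j => integrableOn_pi_unitBall (continuous_abs_det_pow j)) ht ht1 k)
    _ = _ := by rw [detMoment_ballWeight, ENNReal.ofReal_mul (by positivity)]

theorem exists_abs_det_sub_le {ε : ℝ} (hε : 0 < ε) :
    ∃ η > 0, ∀ c : Fin d → ℝ, nsq c < η ^ 2 → ∀ y ∈ Set.univ.pi fun _ : Fin d => unitBall d,
      |(Matrix.of fun j => y j - c).det| ≤ |(Matrix.of y).det| + ε := by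
  have h : ∀ᶠ c : Fin d → ℝ in nhds 0, ∀ y ∈ Set.univ.pi fun _ : Fin d => unitBall d,
      |(Matrix.of fun j => y j - c).det| < |(Matrix.of y).det| + ε := by
    refine isCompact_pi_unitBall.eventually_forall_of_forall_eventually fun y _ => ?_
    have h1 : Continuous fun p : (Fin d → ℝ) × (Fin d → Fin d → ℝ) =>
        |(Matrix.of fun j => p.2 j - p.1).det| :=
      (continuous_det_rows.comp (by fun_prop : Continuous
        fun p : (Fin d → ℝ) × (Fin d → Fin d → ℝ) => fun j => p.2 j - p.1)).abs
    have h2 : Continuous fun p : (Fin d → ℝ) × (Fin d → Fin d → ℝ) =>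
        |(Matrix.of p.2).det| + ε :=
      (continuous_det_rows.comp continuous_snd).abs.add continuous_const
    exact (h1.tendsto (0, y)).eventually_lt (h2.tendsto (0, y)) (by simpa using hε)
  obtain ⟨η, hη, hball⟩ := Metric.eventually_nhds_iff.1 h
  refine ⟨η, hη, fun c hc y hy => (hball ?_ y hy).le⟩
  rw [dist_zero_right]
  exact lt_of_pow_lt_pow_left₀ 2 hη.le ((sq_norm_le_nsq c).trans_lt hc)

theorem setMoment_eq_setLIntegral {A : Set (Fin d → ℝ)} (hA : MeasurableSet A) (k : ℕ) :
    setMoment A k = ∫⁻ y in Set.univ.pi fun _ : Fin (d + 1) => A, ‖sdet y‖ₑ ^ k :=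
  (setLIntegral_univ_pi (fun _ => hA) _).symm

theorem setLIntegral_update_le {L D : Set (Fin d → ℝ)} (hL : MeasurableSet L)
    (hD : MeasurableSet D) {ε : ℝ} {k : ℕ} (hLD : ∀ c ∈ D, ∀ y ∈ Set.univ.pi fun _ : Fin d => L,
      |(Matrix.of fun j => y j - c).det| ≤ |(Matrix.of y).det| + ε) (m : Fin (d + 1)) :
    ∫⁻ y in Set.univ.pi (Function.update (fun _ : Fin (d + 1) => L) m D), ‖sdet y‖ₑ ^ k ≤
      volume D * ∫⁻ y in Set.univ.pi fun _ : Fin d => L,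
        ENNReal.ofReal ((|(Matrix.of y).det| + ε) ^ k) := by
  set A := Function.update (fun _ : Fin (d + 1) => L) m D with hA
  have hF : Measurable fun y : Fin (d + 1) → Fin d → ℝ => ‖sdet y‖ₑ ^ k :=
    measurable_sdet.enorm.pow_const k
  have h := (measurePreserving_piFinSuccAbove (fun i => volume.restrict (A i)) m).symm
  have e : (fun j => volume.restrict (A (m.succAbove j))) = fun _ : Fin d => volume.restrict L := by
    funext j
    rw [hA, Function.update_of_ne (Fin.succAbove_ne m j)]
  have hF' : Measurable fun p : (Fin d → ℝ) × (Fin d → Fin d → ℝ) =>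
      ‖sdet ((MeasurableEquiv.piFinSuccAbove (fun _ => Fin d → ℝ) m).symm p)‖ₑ ^ k :=
    hF.comp h.measurable
  rw [volume_pi, Measure.restrict_pi_pi, ← h.lintegral_comp hF, e,
    lintegral_prod _ hF'.aemeasurable, ← Measure.restrict_pi_pi, ← volume_pi]
  have hm : A m = D := Function.update_self ..
  rw [hm, mul_comm, ← setLIntegral_const]
  refine setLIntegral_mono' hD fun c hc => setLIntegral_mono' (MeasurableSet.univ_pi fun _ => hL)
    fun y hy => ?_
  have hs : |sdet (m.insertNth c y : Fin (d + 1) → Fin d → ℝ)| =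
      |(Matrix.of fun j => y j - c).det| := by
    rw [sdet_eq_det_sub m, abs_mul, abs_pow, abs_neg, abs_one, one_pow, one_mul]
    simp
  change ‖sdet (m.insertNth c y : Fin (d + 1) → Fin d → ℝ)‖ₑ ^ k ≤ _
  rw [Real.enorm_eq_ofReal_abs, hs, ← ENNReal.ofReal_pow (abs_nonneg _)]
  exact ENNReal.ofReal_le_ofReal (pow_le_pow_left₀ (abs_nonneg _) (hLD c hc y hy) k)

theorem setMoment_lt_setMoment {K L : Set (Fin d → ℝ)} (hK : MeasurableSet K)
    (hL : MeasurableSet L) (hKL : K ⊆ L) (hK0 : volume K ≠ 0)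
    (hLt : volume L ≠ ∞) (hKL0 : volume (L \ K) ≠ 0)
    {ε : ℝ} {k : ℕ} (hLD : ∀ c ∈ L \ K, ∀ y ∈ Set.univ.pi fun _ : Fin d => L,
      |(Matrix.of fun j => y j - c).det| ≤ |(Matrix.of y).det| + ε)
    (hfin : setMoment L k ≠ ∞)
    (hlt : volume K * ∫⁻ y in Set.univ.pi fun _ : Fin d => L,
      ENNReal.ofReal ((|(Matrix.of y).det| + ε) ^ k) < setMoment K k) :
    volume K ^ (d + 1) * setMoment L k < volume L ^ (d + 1) * setMoment K k := by
  classical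
  set X := ∫⁻ y in Set.univ.pi fun _ : Fin d => L, ENNReal.ofReal ((|(Matrix.of y).det| + ε) ^ k)
  set A : Finset (Fin (d + 1)) → Fin (d + 1) → Set (Fin d → ℝ) := fun G i => if i ∈ G then L else K
    with hA
  set I : Finset (Fin (d + 1)) → ℝ≥0∞ := fun G => ∫⁻ y in Set.univ.pi (A G), ‖sdet y‖ₑ ^ k with hI
  have hI0 : I ∅ = setMoment K k := by simp [hI, hA, setMoment_eq_setLIntegral hK]
  have hI1 : I Finset.univ = setMoment L k := by simp [hI, hA, setMoment_eq_setLIntegral hL]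
  have hmono : ∀ {G H : Finset (Fin (d + 1))}, G ⊆ H → I G ≤ I H := fun {G H} hGH =>
    lintegral_mono_set (Set.pi_mono fun i _ => by
      by_cases hG : i ∈ G
      · simp [hA, hG, hGH hG]
      · by_cases hH : i ∈ H <;> simp [hA, hG, hH, hKL])
  have hItop : ∀ G, I G ≠ ∞ := fun G =>
    ne_top_of_le_ne_top hfin ((hmono (Finset.subset_univ G)).trans_eq hI1)
  have hKt : volume K ≠ ∞ := ne_top_of_le_ne_top hLt (measure_mono hKL)
  have hDt : volume (L \ K) ≠ ∞ := ne_top_of_le_ne_top hLt (measure_mono Set.sdiff_subset)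
  have hvol : volume L = volume K + volume (L \ K) := by
    rw [add_comm, ← measure_sdiff_add_inter L hK, Set.inter_eq_self_of_subset_right hKL]
  have hstep : ∀ G (m : Fin (d + 1)), volume K * I (insert m G) < volume L * I G := by
    intro G m
    have h1 : I (insert m G) ≤ I G + volume (L \ K) * X := by
      have hsub : Set.univ.pi (A (insert m G)) ⊆ Set.univ.pi (A G) ∪
          Set.univ.pi (Function.update (fun _ : Fin (d + 1) => L) m (L \ K)) := by
        intro y hy
        have hyL : ∀ i, y i ∈ L := fun i => by
          have := hy i (Set.mem_univ i)
          simp only [hA] at this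
          split_ifs at this
          exacts [this, hKL this]
        by_cases hm : y m ∈ K
        · left
          intro i _
          by_cases him : i = m
          · subst him
            by_cases hG : i ∈ G <;> simp [hA, hG, hm, hyL]
          · simpa [hA, him] using hy i (Set.mem_univ i)
        · right
          intro i _
          by_cases him : i = m
          · subst him; simp [hm, hyL]
          · simp [him, hyL]
      calc I (insert m G) ≤ _ := lintegral_mono_set hsub
        _ ≤ _ := lintegral_union_le _ _ _
        _ ≤ _ := add_le_add_right (setLIntegral_update_le hL (hL.diff hK) hLD m) _
    calc volume K * I (insert m G) ≤ volume K * (I G + volume (L \ K) * X) := by gcongr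
      _ = volume K * I G + volume (L \ K) * (volume K * X) := by ring
      _ < volume K * I G + volume (L \ K) * I G := by
        refine ENNReal.add_lt_add_left (ENNReal.mul_ne_top hKt (hItop G)) ?_
        refine ENNReal.mul_lt_mul_right hKL0 hDt ?_
        exact hlt.trans_le (hI0.symm.trans_le (hmono (Finset.empty_subset G)))
      _ = volume L * I G := by rw [hvol, add_mul]
  have hle : ∀ G, volume K ^ G.card * I G ≤ volume L ^ G.card * I ∅ := by
    intro G
    induction G using Finset.induction with
    | empty => simp
    | insert m G hm ih =>
      rw [Finset.card_insert_of_notMem hm, pow_succ, pow_succ, mul_assoc, mul_right_comm]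
      calc volume K ^ G.card * (volume K * I (insert m G))
          ≤ volume K ^ G.card * (volume L * I G) :=
            mul_le_mul_right (hstep G m).le _
        _ = volume K ^ G.card * I G * volume L := by ring
        _ ≤ _ := by gcongr
  have huniv : insert (0 : Fin (d + 1)) (Finset.univ.erase (0 : Fin (d + 1))) = Finset.univ :=
    Finset.insert_erase (Finset.mem_univ 0)
  have hcard : (Finset.univ.erase (0 : Fin (d + 1))).card = d := by simp
  have h1 := hstep (Finset.univ.erase (0 : Fin (d + 1))) 0
  have h2 := hle (Finset.univ.erase (0 : Fin (d + 1)))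
  rw [huniv, hI1] at h1
  rw [hcard, hI0] at h2
  calc volume K ^ (d + 1) * setMoment L k = volume K ^ d * (volume K * setMoment L k) := by ring
    _ < volume K ^ d * (volume L * I (Finset.univ.erase (0 : Fin (d + 1)))) :=
      ENNReal.mul_lt_mul_right (pow_ne_zero _ hK0) (ENNReal.pow_ne_top hKt) h1
    _ = volume L * (volume K ^ d * I (Finset.univ.erase (0 : Fin (d + 1)))) := by ring
    _ ≤ volume L * (volume L ^ d * setMoment K k) := by gcongr
    _ = _ := by ring

theorem setMoment_ne_top {A : Set (Fin d → ℝ)} (hA : IsCompact A) (k : ℕ) :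
    setMoment A k ≠ ∞ := by
  rw [setMoment_eq_setLIntegral hA.measurableSet]
  have h : IntegrableOn (fun y : Fin (d + 1) → Fin d → ℝ => sdet y ^ k)
      (Set.univ.pi fun _ => A) :=
    (continuous_sdet.pow k).continuousOn.integrableOn_compact (isCompact_univ_pi fun _ => hA)
  have h2 := h.2
  simp only [HasFiniteIntegral, enorm_pow] at h2
  exact h2.ne

section TruncCone

variable [NeZero d]

theorem nsq_single_zero (r : ℝ) : nsq (Pi.single (0 : Fin d) r) = r ^ 2 := by
  simp [nsq_eq, Pi.single_apply, ite_pow]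

theorem isOpen_openSlab (δ a b : ℝ) :
    IsOpen {x : Fin d → ℝ | nsq x < 1 ∧ δ * √(nsq x) < x 0 ∧ a < x 0 ∧ x 0 < b} := by
  have h : Continuous fun x : Fin d → ℝ => δ * √(nsq x) :=
    continuous_const.mul continuous_nsq.sqrt
  have h0 : Continuous fun x : Fin d → ℝ => x 0 := continuous_apply 0
  exact (isOpen_lt continuous_nsq continuous_const).inter ((isOpen_lt h h0).inter
    ((isOpen_lt continuous_const h0).inter (isOpen_lt h0 continuous_const)))

theorem single_zero_mem_openSlab {δ a b r : ℝ} (hδ : δ < 1) (hr : 0 < r) (hr1 : r < 1)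
    (ha : a < r) (hb : r < b) : Pi.single (0 : Fin d) r ∈
      {x : Fin d → ℝ | nsq x < 1 ∧ δ * √(nsq x) < x 0 ∧ a < x 0 ∧ x 0 < b} := by
  refine ⟨?_, ?_, by simpa using ha, by simpa using hb⟩
  · rw [nsq_single_zero]; nlinarith
  · rw [nsq_single_zero, Real.sqrt_sq hr.le, Pi.single_eq_same]; nlinarith

theorem interior_truncCone_nonempty {δ τ : ℝ} (hδ : δ < 1) (hτ : 0 ≤ τ) (hτ1 : τ < 1) :
    (interior (truncCone d δ τ)).Nonempty :=
  ⟨_, mem_interior.2 ⟨_, fun _ hx => ⟨hx.1.le, hx.2.1.le, hx.2.2.1.le⟩, isOpen_openSlab δ τ 1,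
    single_zero_mem_openSlab (r := (τ + 1) / 2) hδ (by linarith) (by linarith) (by linarith)
      (by linarith)⟩⟩

theorem volume_truncCone_ne_zero {δ τ : ℝ} (hδ : δ < 1) (hτ : 0 ≤ τ) (hτ1 : τ < 1) :
    volume (truncCone d δ τ) ≠ 0 :=
  (Measure.measure_pos_of_nonempty_interior _ (interior_truncCone_nonempty hδ hτ hτ1)).ne'

theorem volume_truncCone_sdiff_ne_zero {δ τ : ℝ} (hδ : δ < 1) (hτ : 0 < τ) (hτ1 : τ < 1) :
    volume (truncCone d δ 0 \ truncCone d δ τ) ≠ 0 := by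
  have h := (isOpen_openSlab (d := d) δ 0 τ).measure_pos volume
    ⟨_, single_zero_mem_openSlab (r := τ / 2) hδ (by linarith) (by linarith) (by linarith)
      (by linarith)⟩
  refine (h.trans_le (measure_mono fun x hx => ?_)).ne'
  exact ⟨⟨hx.1.le, hx.2.1.le, hx.2.2.1.le⟩, fun hK => hx.2.2.2.not_ge hK.2.2⟩

theorem truncCone_subset_unitBall (δ τ : ℝ) : truncCone d δ τ ⊆ unitBall d := fun _ hx => hx.1

theorem volume_truncCone_ne_top (δ τ : ℝ) : volume (truncCone d δ τ) ≠ ∞ :=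
  ne_top_of_le_ne_top isCompact_unitBall.measure_ne_top
    (measure_mono (truncCone_subset_unitBall δ τ))

theorem isCompact_truncCone (δ τ : ℝ) : IsCompact (truncCone d δ τ) :=
  isCompact_unitBall.of_isClosed_subset (isClosed_truncCone δ τ) (truncCone_subset_unitBall δ τ)

theorem nsq_lt_of_mem_truncCone_sdiff {δ τ η : ℝ} (hδ : 0 < δ) (hη : 0 < η) (hτ : τ ≤ δ * η)
    {c : Fin d → ℝ} (hc : c ∈ truncCone d δ 0 \ truncCone d δ τ) : nsq c < η ^ 2 := by
  obtain ⟨⟨h1, h2, -⟩, h3⟩ := hc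
  have h4 : c 0 < τ := by
    by_contra h
    exact h3 ⟨h1, h2, not_lt.1 h⟩
  have h5 : √(nsq c) < η := lt_of_mul_lt_mul_left ((h2.trans_lt h4).trans_le hτ) hδ.le
  rwa [Real.sqrt_lt' hη] at h5

end TruncCone

theorem exists_lt_one_lt_pow_mul {ρ : ℝ} (hρ : 1 < ρ) (n : ℕ) :
    ∃ t : ℝ, 0 < t ∧ t < 1 ∧ 1 < t ^ n * ρ := by
  have hc : Filter.Tendsto (fun t : ℝ => t ^ n * ρ) (nhdsWithin 1 (Set.Iio 1)) (nhds ρ) := by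
    have : Continuous fun t : ℝ => t ^ n * ρ := by fun_prop
    simpa using (this.tendsto 1).mono_left nhdsWithin_le_nhds
  obtain ⟨t, ⟨h1, h2⟩, h3⟩ := ((hc.eventually (lt_mem_nhds hρ)).and
    ((eventually_nhdsWithin_of_eventually_nhds (lt_mem_nhds zero_lt_one)))).and
    self_mem_nhdsWithin |>.exists
  exact ⟨t, h2, h3, h1⟩

theorem inv_pow_lt_of_one_lt {t ρ : ℝ} {k : ℕ} (ht : 0 < t) (ht1 : t < 1) (hρ : 0 < ρ)
    (h : 1 < t ^ (d * (d + 2) + 1) * ρ) (hk : 1 ≤ k) :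
    (t ^ k)⁻¹ < t ^ (d * (k + d + 1)) * ρ ^ k := by
  rw [inv_lt_iff_one_lt_mul₀ (pow_pos ht k)]
  have hexp : d * (k + d + 1) ≤ d * (d + 2) * k := by
    have := Nat.mul_le_mul_left (d * (d + 1)) hk
    nlinarith
  calc (1 : ℝ) < (t ^ (d * (d + 2) + 1) * ρ) ^ k := one_lt_pow₀ h (by omega)
    _ = t ^ k * (t ^ (d * (d + 2) * k) * ρ ^ k) := by ring
    _ ≤ t ^ k * (t ^ (d * (k + d + 1)) * ρ ^ k) := by
      have := pow_le_pow_of_le_one ht.le ht1.le hexp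
      gcongr
    _ = _ := mul_comm _ _

theorem detMoment_ballWeight_ne_zero (k : ℕ) : detMoment ballWeight d k ≠ 0 := by
  rw [detMoment_ballWeight]
  exact (ENNReal.ofReal_pos.2 (setIntegral_abs_det_pow_pos k)).ne'

theorem volume_truncCone_mul_setLIntegral_lt [NeZero d] {t τ ρ : ℝ} {k : ℕ} (ht : 0 < t)
    (ht1 : t < 1) (hτ0 : 0 ≤ τ) (hτ : τ ≤ 1 - t) (hρ : 0 < ρ)
    (h : 1 < t ^ (d * (d + 2) + 1) * ρ) (hk : 1 ≤ k)
    (hmom : ENNReal.ofReal ((2 * ρ) ^ k) * (ballVol d * detMoment ballWeight d k) ≤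
      simplexMoment ballWeight d k) :
    volume (truncCone d (1 - t) τ) * ∫⁻ y in Set.univ.pi fun _ : Fin d => truncCone d (1 - t) 0,
      ENNReal.ofReal ((|(Matrix.of y).det| + (1 - t) * meanDet d) ^ k) <
        setMoment (truncCone d (1 - t) τ) k := by
  set X := ∫⁻ y in Set.univ.pi fun _ : Fin d => truncCone d (1 - t) 0,
      ENNReal.ofReal ((|(Matrix.of y).det| + (1 - t) * meanDet d) ^ k)
  have hX : 2 ^ d * X ≤ _ := setLIntegral_abs_det_add_pow_le ht ht1 (1 - t) k
  have hv : 2 * volume (truncCone d (1 - t) τ) ≤ ballVol d := by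
    rw [ballVol_eq_two_mul]
    have hsub : truncCone d (1 - t) τ ⊆ halfBall d := fun x hx => ⟨hx.1, hτ0.trans hx.2.2⟩
    exact mul_le_mul_right (measure_mono hsub) _
  have hN : detMoment ballWeight d k ≠ ∞ := by simp [detMoment_ballWeight]
  have hb : ballVol d ≠ ∞ := volume_unitBall (d := d) ▸ isCompact_unitBall.measure_ne_top
  have hb0 : ballVol d ≠ 0 := fun h0 =>
    volume_truncCone_ne_zero (d := d) (δ := 1 - t) (τ := τ) (by linarith) hτ0 (by linarith)
      (by simpa [h0] using hv)
  have h2 : ((2 : ℝ≥0∞) ^ (d + 1)) ≠ ∞ := ENNReal.pow_ne_top (by simp)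
  refine (ENNReal.mul_lt_mul_iff_right (pow_ne_zero (d + 1) two_ne_zero) h2).1 ?_
  calc (2 : ℝ≥0∞) ^ (d + 1) * (volume (truncCone d (1 - t) τ) * X)
      = (2 * volume (truncCone d (1 - t) τ)) * (2 ^ d * X) := by ring
    _ ≤ ballVol d * (ENNReal.ofReal (t ^ k)⁻¹ * detMoment ballWeight d k) := mul_le_mul' hv hX
    _ = (ballVol d * detMoment ballWeight d k) * ENNReal.ofReal (t ^ k)⁻¹ := by ring
    _ < (ballVol d * detMoment ballWeight d k) *
          ENNReal.ofReal (t ^ (d * (k + d + 1)) * ρ ^ k) := by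
      refine ENNReal.mul_lt_mul_right (mul_ne_zero hb0 (detMoment_ballWeight_ne_zero k))
        (ENNReal.mul_ne_top hb hN) ?_
      exact (ENNReal.ofReal_lt_ofReal_iff (by positivity)).2
        (inv_pow_lt_of_one_lt ht ht1 hρ h hk)
    _ = 2 ^ (d + 1) * (ENNReal.ofReal ((t ^ d / 2) ^ (k + d + 1)) *
          (ENNReal.ofReal ((2 * ρ) ^ k) * (ballVol d * detMoment ballWeight d k))) := by
      have e : t ^ (d * (k + d + 1)) * ρ ^ k =
          2 ^ (d + 1) * ((t ^ d / 2) ^ (k + d + 1) * (2 * ρ) ^ k) := by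
        rw [div_pow, ← pow_mul, mul_pow]
        field_simp
        ring
      rw [e, ENNReal.ofReal_mul (by positivity), ENNReal.ofReal_mul (by positivity),
        ENNReal.ofReal_pow (by norm_num), ENNReal.ofReal_ofNat]
      ring
    _ ≤ 2 ^ (d + 1) * setMoment (truncCone d (1 - t) τ) k :=
      mul_le_mul_right ((mul_le_mul_right hmom _).trans (le_setMoment_truncCone ht ht1 hτ hk)) _

theorem exists_setMoment_truncCone_lt [NeZero d] (hd : 4 ≤ d) :
    ∃ δ τ : ℝ, 0 < δ ∧ δ < 1 ∧ 0 < τ ∧ τ < 1 ∧ ∀ k, 1 ≤ k →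
      volume (truncCone d δ τ) ^ (d + 1) * setMoment (truncCone d δ 0) k <
        volume (truncCone d δ 0) ^ (d + 1) * setMoment (truncCone d δ τ) k := by
  obtain ⟨ρ, hρ, hmom⟩ := exists_pow_le_simplexMoment hd
  obtain ⟨t, ht, ht1, htρ⟩ := exists_lt_one_lt_pow_mul hρ (d * (d + 2) + 1)
  have hδ : 0 < 1 - t := by linarith
  obtain ⟨η, hη, hdet⟩ := exists_abs_det_sub_le (d := d) (mul_pos hδ (meanDet_pos (d := d)))
  have hτ0 : 0 < min (1 - t) ((1 - t) * η) := lt_min hδ (mul_pos hδ hη)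
  have hτ := min_le_left (1 - t) ((1 - t) * η)
  have hτη := min_le_right (1 - t) ((1 - t) * η)
  set τ := min (1 - t) ((1 - t) * η)
  refine ⟨1 - t, τ, hδ, by linarith, hτ0, by linarith, fun k hk => ?_⟩
  have hsub : truncCone d (1 - t) τ ⊆ truncCone d (1 - t) 0 :=
    fun x hx => ⟨hx.1, hx.2.1, hτ0.le.trans hx.2.2⟩
  refine setMoment_lt_setMoment (measurableSet_truncCone _ _) (measurableSet_truncCone _ _) hsub
    (volume_truncCone_ne_zero (by linarith) hτ0.le (by linarith)) (volume_truncCone_ne_top _ _)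
    (volume_truncCone_sdiff_ne_zero (by linarith) hτ0 (by linarith))
    (fun c hc y hy => hdet c (nsq_lt_of_mem_truncCone_sdiff hδ hη hτη hc) y
      fun i hi => truncCone_subset_unitBall _ _ (hy i hi))
    (setMoment_ne_top (isCompact_truncCone _ _) k)
    (volume_truncCone_mul_setLIntegral_lt ht ht1 hτ0.le hτ (by linarith) htρ hk (hmom k hk))

/-- The vertices of the standard simplex, in Euclidean space. -/
noncomputable def stdVertex (d : ℕ) : Fin (d + 1) → EuclideanSpace ℝ (Fin d) :=
  Fin.cons 0 fun j => EuclideanSpace.single j 1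

/-- The volume of the standard simplex. -/
noncomputable def stdVol (d : ℕ) : ℝ := (volume (convexHull ℝ (Set.range (stdVertex d)))).toReal

theorem affineSpan_stdVertex : affineSpan ℝ (Set.range (stdVertex d)) = ⊤ := by
  rw [AffineSubspace.affineSpan_eq_top_iff_vectorSpan_eq_top_of_nonempty ℝ _ _
      (Set.range_nonempty _),
    vectorSpan_range_eq_span_range_vsub_right ℝ _ 0, eq_top_iff]
  rw [← (EuclideanSpace.basisFun (Fin d) ℝ).toBasis.span_eq]
  refine Submodule.span_mono ?_
  rintro _ ⟨j, rfl⟩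
  exact ⟨j.succ, by simp [stdVertex]⟩

theorem stdVol_pos : 0 < stdVol d := by
  refine ENNReal.toReal_pos (Measure.measure_pos_of_nonempty_interior _
    (interior_convexHull_nonempty_iff_affineSpan_eq_top.2 affineSpan_stdVertex)).ne' ?_
  exact ((Set.finite_range _).isCompact_convexHull (𝕜 := ℝ)).measure_ne_top

theorem volume_convexHull_range_toReal (X : Fin (d + 1) → EuclideanSpace ℝ (Fin d)) :
    (volume (convexHull ℝ (Set.range X))).toReal = stdVol d * |sdet fun i => (X i).ofLp| := by
  set M : Matrix (Fin d) (Fin d) ℝ := Matrix.of fun j => (X j.succ).ofLp - (X 0).ofLp with hM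
  set f : EuclideanSpace ℝ (Fin d) →ₗ[ℝ] EuclideanSpace ℝ (Fin d) :=
    Matrix.toLpLin 2 2 M.transpose with hf
  have hX : Set.range X =
      (fun z => X 0 + z) '' (f '' Set.range (stdVertex d)) := by
    rw [← Set.range_comp, ← Set.range_comp]
    congr 1
    funext i
    refine Fin.cases ?_ (fun j => ?_) i
    · simp [stdVertex]
    · have : f (EuclideanSpace.single j 1) = X j.succ - X 0 := by
        ext l
        simp [f, hM, Matrix.toLpLin_apply]
      simp [stdVertex, this]
  have hdet : LinearMap.det f = sdet fun i => (X i).ofLp := by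
    rw [sdet_eq_det_sub 0, hf, Matrix.toLpLin_eq_toLin, LinearMap.det_toLin,
      Matrix.det_transpose]
    simp [hM]
  have hc : convexHull ℝ (Set.range X) =
      (fun z => X 0 + z) '' (f '' convexHull ℝ (Set.range (stdVertex d))) := by
    rw [f.image_convexHull, hX]
    exact ((AffineEquiv.constVAdd ℝ _ (X 0)).toAffineMap.image_convexHull _).symm
  rw [hc, Set.image_add_left, measure_preimage_add, Measure.addHaar_image_linearMap, hdet,
    ENNReal.toReal_mul, ENNReal.toReal_ofReal (abs_nonneg _), mul_comm, stdVol]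

/-- The set of points of Euclidean space whose coordinates lie in `A`. -/
def euclidean (A : Set (Fin d → ℝ)) : Set (EuclideanSpace ℝ (Fin d)) := WithLp.ofLp ⁻¹' A

theorem momentVolSimplex_euclidean {A : Set (Fin d → ℝ)} (hA : MeasurableSet A) (k : ℕ) :
    momentVolSimplex d k (euclidean A) =
      stdVol d ^ k * ((volume A ^ (d + 1)).toReal⁻¹ * (setMoment A k).toReal) := by
  set Φ : (Fin (d + 1) → EuclideanSpace ℝ (Fin d)) ≃ᵐ (Fin (d + 1) → Fin d → ℝ) :=
    MeasurableEquiv.piCongrRight fun _ => (MeasurableEquiv.toLp 2 (Fin d → ℝ)).symm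
  have hΦ : MeasurePreserving Φ volume volume :=
    volume_preserving_pi fun _ => PiLp.volume_preserving_ofLp (Fin d)
  have hpre : (Set.univ.pi fun _ : Fin (d + 1) => euclidean A) =
      Φ ⁻¹' (Set.univ.pi fun _ : Fin (d + 1) => A) := rfl
  have hvol : volume (Set.univ.pi fun _ : Fin (d + 1) => euclidean A) = volume A ^ (d + 1) := by
    rw [hpre, hΦ.measure_preimage_equiv, volume_pi_pi]
    simp
  have hInt : ∫ y in Set.univ.pi fun _ : Fin (d + 1) => A, |sdet y| ^ k =
      (setMoment A k).toReal := by
    have h := integral_norm_eq_lintegral_enorm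
      (μ := volume.restrict (Set.univ.pi fun _ : Fin (d + 1) => A))
      ((measurable_sdet (d := d)).pow_const k).aestronglyMeasurable
    simpa only [norm_pow, Real.norm_eq_abs, enorm_pow, ← setMoment_eq_setLIntegral hA] using h
  have htrans := hΦ.setIntegral_preimage_emb Φ.measurableEmbedding (fun y => |sdet y| ^ k)
    (Set.univ.pi fun _ : Fin (d + 1) => A)
  rw [momentVolSimplex, setAverage_eq, measureReal_def, hvol, smul_eq_mul]
  simp_rw [volume_convexHull_range_toReal, mul_pow]
  rw [integral_const_mul, hpre, ← hInt, ← htrans]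
  exact mul_left_comm _ _ _

theorem momentVolSimplex_euclidean_lt {K L : Set (Fin d → ℝ)} (hK : MeasurableSet K)
    (hL : MeasurableSet L) (hK0 : volume K ≠ 0) (hKt : volume K ≠ ∞) (hL0 : volume L ≠ 0)
    (hLt : volume L ≠ ∞) {k : ℕ} (hKk : setMoment K k ≠ ∞)
    (h : volume K ^ (d + 1) * setMoment L k < volume L ^ (d + 1) * setMoment K k) :
    momentVolSimplex d k (euclidean L) < momentVolSimplex d k (euclidean K) := by
  rw [momentVolSimplex_euclidean hK, momentVolSimplex_euclidean hL]
  refine mul_lt_mul_of_pos_left ?_ (pow_pos stdVol_pos k)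
  have h' := ENNReal.toReal_strict_mono (ENNReal.mul_ne_top (ENNReal.pow_ne_top hLt) hKk) h
  rw [ENNReal.toReal_mul, ENNReal.toReal_mul] at h'
  have hKp : 0 < (volume K ^ (d + 1)).toReal :=
    ENNReal.toReal_pos (pow_ne_zero _ hK0) (ENNReal.pow_ne_top hKt)
  have hLp : 0 < (volume L ^ (d + 1)).toReal :=
    ENNReal.toReal_pos (pow_ne_zero _ hL0) (ENNReal.pow_ne_top hLt)
  rw [inv_mul_lt_iff₀ hLp, mul_left_comm, lt_inv_mul_iff₀ hKp]
  exact h'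

theorem nsq_ofLp (x : EuclideanSpace ℝ (Fin d)) : nsq x.ofLp = ‖x‖ ^ 2 :=
  (norm_toLp_sq x.ofLp).symm

theorem isConvexBody_euclidean_truncCone [NeZero d] {δ τ : ℝ} (hδ : 0 ≤ δ) (hδ1 : δ < 1)
    (hτ : 0 ≤ τ) (hτ1 : τ < 1) : IsConvexBody (euclidean (truncCone d δ τ)) := by
  have hcont : Continuous (WithLp.ofLp : EuclideanSpace ℝ (Fin d) → Fin d → ℝ) :=
    PiLp.continuous_ofLp 2 _
  have hmem : ∀ x : EuclideanSpace ℝ (Fin d), x ∈ euclidean (truncCone d δ τ) ↔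
      ‖x‖ ≤ 1 ∧ δ * ‖x‖ ≤ x 0 ∧ τ ≤ x 0 := fun x => by
    change nsq x.ofLp ≤ 1 ∧ δ * √(nsq x.ofLp) ≤ x 0 ∧ τ ≤ x 0 ↔ _
    rw [nsq_ofLp, Real.sqrt_sq (norm_nonneg x), sq_le_one_iff₀ (norm_nonneg x)]
  refine ⟨?_, fun x hx y hy a b ha hb hab => ?_, ?_⟩
  · refine (isCompact_closedBall (0 : EuclideanSpace ℝ (Fin d)) 1).of_isClosed_subset
      ((isClosed_truncCone δ τ).preimage hcont) fun x hx => ?_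
    simpa using ((hmem x).1 hx).1
  · rw [hmem] at hx hy ⊢
    have hn : ‖a • x + b • y‖ ≤ a * ‖x‖ + b * ‖y‖ := by
      simpa [norm_smul, abs_of_nonneg ha, abs_of_nonneg hb] using norm_add_le (a • x) (b • y)
    have h0 : (a • x + b • y) 0 = a * x 0 + b * y 0 := by simp
    rw [h0]
    obtain ⟨hx1, hx2, hx3⟩ := hx
    obtain ⟨hy1, hy2, hy3⟩ := hy
    have hb' : b = 1 - a := by linarith
    subst hb'
    exact ⟨by nlinarith, by nlinarith, by nlinarith⟩
  · obtain ⟨x, hx⟩ := interior_truncCone_nonempty (d := d) hδ1 hτ hτ1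
    exact ⟨WithLp.toLp 2 x, preimage_interior_subset_interior_preimage hcont hx⟩

end RandomSimplex

/-- For every `d ≥ 4` there are convex bodies `K ⊆ L` in `ℝ^d` such that
`E(V_K^k) > E(V_L^k)` for every integer `k ≥ 1`. -/
theorem momentVolSimplex_not_monotone_high_dim
    (d : ℕ) (hd : 4 ≤ d) :
    ∃ K L : Set (EuclideanSpace ℝ (Fin d)),
      IsConvexBody K ∧ IsConvexBody L ∧ K ⊆ L ∧
      ∀ k : ℕ, 1 ≤ k → momentVolSimplex d k K > momentVolSimplex d k L := by
  have : NeZero d := ⟨by omega⟩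
  obtain ⟨δ, τ, hδ, hδ1, hτ, hτ1, h⟩ := RandomSimplex.exists_setMoment_truncCone_lt hd
  refine ⟨RandomSimplex.euclidean (RandomSimplex.truncCone d δ τ),
    RandomSimplex.euclidean (RandomSimplex.truncCone d δ 0),
    RandomSimplex.isConvexBody_euclidean_truncCone hδ.le hδ1 hτ.le hτ1,
    RandomSimplex.isConvexBody_euclidean_truncCone hδ.le hδ1 le_rfl one_pos,
    fun x hx => ⟨hx.1, hx.2.1, hτ.le.trans hx.2.2⟩, fun k hk => ?_⟩
  exact RandomSimplex.momentVolSimplex_euclidean_lt (RandomSimplex.measurableSet_truncCone δ τ)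
    (RandomSimplex.measurableSet_truncCone δ 0)
    (RandomSimplex.volume_truncCone_ne_zero hδ1 hτ.le hτ1)
    (RandomSimplex.volume_truncCone_ne_top δ τ)
    (RandomSimplex.volume_truncCone_ne_zero hδ1 le_rfl one_pos)
    (RandomSimplex.volume_truncCone_ne_top δ 0)
    (RandomSimplex.setMoment_ne_top (RandomSimplex.isCompact_truncCone δ τ) k) (h k hk)
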